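/- arXiv:1709.02424 — 2 statements merged into one kernel-verified Lean document; each statement's English description precedes it below -/
import Mathlib

section
/- Let S ⊆ ℝⁿ be a centrally symmetric convex body of class C²₊ (C² boundary with everywhere strictly positive Gauss curvature). For every ε > 0 there is Δ₀ > 0 such that for every 0 ≤ Δ ≤ Δ₀ and every x ∈ ∂S the following holds: writing S₁ = S ∩ {ξ : ⟨ξ − x, u(x)⟩ ≤ −(1+ε)Δ} and S₂ = S ∩ {ξ : ⟨ξ − x, u(x)⟩ ≥ −(1+ε)Δ}, one has conv(S ∪ {x + Δ·u(x)}) = S₁ ∪ conv(S₂ ∪ {x + Δ·u(x)}). -/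
open MeasureTheory Metric Set Filter
open scoped RealInnerProductSpace Pointwise Topology

noncomputable section

abbrev Euc (n : ℕ) : Type := EuclideanSpace ℝ (Fin n)

/-- A centrally symmetric convex body in `ℝⁿ`. -/
def IsSymConvexBody {n : ℕ} (S : Set (Euc n)) : Prop :=
  IsCompact S ∧ Convex ℝ S ∧ (interior S).Nonempty ∧ S = -S

/-- The convex floating body `K_δ`: the intersection of all closed halfspaces whose bounding
hyperplane cuts off a set of volume at most `δ·|K|ₙ` from `K`. -/
def floatingBody {n : ℕ} (K : Set (Euc n)) (δ : ℝ) : Set (Euc n) :=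
  ⋂ (v : Euc n) (_ : v ≠ 0) (c : ℝ)
    (_ : volume (K ∩ {y | c ≤ ⟪v, y⟫}) ≤ ENNReal.ofReal δ * volume K),
    {y | ⟪v, y⟫ ≤ c}

/-- The illumination body `K^δ`. -/
def illuminationBody {n : ℕ} (K : Set (Euc n)) (δ : ℝ) : Set (Euc n) :=
  {x | volume (convexHull ℝ (K ∪ {x})) ≤ ENNReal.ofReal (1 + δ) * volume K}

/-- The polar body `K°`. -/
def polarBody {n : ℕ} (K : Set (Euc n)) : Set (Euc n) :=
  {y | ∀ x ∈ K, ⟪x, y⟫ ≤ 1}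

/-- The distance `d(C₁, C₂) = inf {a ≥ 1 : a⁻¹ C₁ ⊆ C₂ ⊆ a C₁}`. -/
def bodyDist {n : ℕ} (C₁ C₂ : Set (Euc n)) : ℝ :=
  sInf {a : ℝ | 1 ≤ a ∧ a⁻¹ • C₁ ⊆ C₂ ∧ C₂ ⊆ a • C₁}

/-- `d_C(δ) = inf_{δ' > 0} d(C_δ, ((C°)^{δ'})°)`. -/
def dualDist {n : ℕ} (C : Set (Euc n)) (δ : ℝ) : ℝ :=
  sInf {r : ℝ | ∃ δ' > (0:ℝ), r = bodyDist (floatingBody C δ)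
      (polarBody (illuminationBody (polarBody C) δ'))}

/-- `ν` is an outer unit normal of `S` at `x`. -/
def IsOuterNormalAt {n : ℕ} (S : Set (Euc n)) (x ν : Euc n) : Prop :=
  ‖ν‖ = 1 ∧ ∀ y ∈ S, ⟪y, ν⟫ ≤ ⟪x, ν⟫

/-- Near `x ∈ ∂S`, the boundary of `S` is the graph of a `C²` function `f` over the tangent
hyperplane at `x` (embedded via a linear isometry `L` orthogonal to the normal `ν`), with
`f 0 = 0` and vanishing derivative at `0`, and `k` is the determinant of the Hessian of `f`
at `0`, i.e. the Gauss curvature of `∂S` at `x`. -/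
def IsGaussCurvatureAt {n : ℕ} (S : Set (Euc n)) (x ν : Euc n) (k : ℝ) : Prop :=
  ∃ (L : Euc (n-1) →ₗᵢ[ℝ] Euc n) (f : Euc (n-1) → ℝ) (τ ε : ℝ),
    0 < τ ∧ 0 < ε ∧
    (∀ v, ⟪L v, ν⟫ = 0) ∧
    ContDiffOn ℝ 2 f (ball 0 τ) ∧
    f 0 = 0 ∧ fderiv ℝ f 0 = 0 ∧
    frontier S ∩ ball x ε
      = {y | ∃ v ∈ ball (0 : Euc (n-1)) τ, y = x + L v - f v • ν} ∩ ball x ε ∧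
    k = (Matrix.of fun i j : Fin (n-1) =>
      iteratedFDeriv ℝ 2 f 0 ![EuclideanSpace.single i 1, EuclideanSpace.single j 1]).det

/-- `S` has `C²` boundary, with outer unit normal map `u` and Gauss curvature function `κ`. -/
def IsC2Body {n : ℕ} (S : Set (Euc n)) (u : Euc n → Euc n) (κ : Euc n → ℝ) : Prop :=
  ∀ x ∈ frontier S, IsOuterNormalAt S x (u x) ∧ IsGaussCurvatureAt S x (u x) (κ x)

/-- The constant `c(K, n) = ((n+1)^{2/(n+1)}/2)·(|K|ₙ/|B₂^{n−1}|_{n−1})^{2/(n+1)}`. -/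
def cConst (n : ℕ) (K : Set (Euc n)) : ℝ :=
  ((n + 1 : ℝ) ^ ((2:ℝ)/(n+1)) / 2) *
    ((volume K).toReal / (volume (ball (0 : Euc (n-1)) 1)).toReal) ^ ((2:ℝ)/(n+1))

/-- The function `G_S(x) = c(S,n)·κ(x)^{1/(n+1)} / ⟨x, u(x)⟩`. -/
def Gfun {n : ℕ} (S : Set (Euc n)) (u : Euc n → Euc n) (κ : Euc n → ℝ) (x : Euc n) : ℝ :=
  cConst n S * (κ x) ^ ((1:ℝ)/(n+1)) / ⟪x, u x⟫

/-- The error of the first order Taylor expansion of `f` at `a`, evaluated at `b`. -/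
def bregman {E : Type*} [NormedAddCommGroup E] [NormedSpace ℝ E] (f : E → ℝ) (a b : E) : ℝ :=
  f b - f a - fderiv ℝ f a (b - a)

lemma exists_ball_abs_bregman_sub_le {E : Type*} [NormedAddCommGroup E] [NormedSpace ℝ E]
    {f : E → ℝ} {z : E} (hf : ContDiffAt ℝ 2 f z) {δ : ℝ} (hδ : 0 < δ) :
    ∃ r > 0, ∀ a ∈ ball z r, ∀ b ∈ ball z r,
      |bregman f a b - fderiv ℝ (fderiv ℝ f) z (b - a) (b - a) / 2| ≤ δ * ‖b - a‖ ^ 2 := by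
  have h1 : HasStrictFDerivAt (fderiv ℝ f) (fderiv ℝ (fderiv ℝ f) z) z :=
    (hf.fderiv_right (m := 1) (by norm_num)).hasStrictFDerivAt (by norm_num)
  have h2 := (hasStrictFDerivAt_iff_isLittleO.1 h1).def hδ
  have h3 : ∀ᶠ y in 𝓝 z, DifferentiableAt ℝ f y :=
    (hf.eventually (by norm_num)).mono fun y hy => hy.differentiableAt (by norm_num)
  rw [nhds_prod_eq] at h2
  obtain ⟨t, ht, h2⟩ := Filter.eventually_prod_self_iff'.1 h2
  obtain ⟨r, hr, hball⟩ := Metric.eventually_nhds_iff_ball.1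
    ((show ∀ᶠ y in 𝓝 z, y ∈ t from ht).and h3)
  refine ⟨r, hr, fun a ha b hb => ?_⟩
  set H := fderiv ℝ (fderiv ℝ f) z
  set v := b - a with hv
  have hseg : ∀ t ∈ Icc (0 : ℝ) 1, a + t • v ∈ ball z r := fun t ht => by
    have := (convex_ball z r).add_smul_sub_mem ha hb ht
    simpa using this
  have hder : ∀ t ∈ Icc (0 : ℝ) 1, HasDerivWithinAt
      (fun t : ℝ => f (a + t • v) - t * fderiv ℝ f a v - t ^ 2 / 2 * H v v)
      (fderiv ℝ f (a + t • v) v - fderiv ℝ f a v - t * H v v) (Icc 0 1) t := fun t ht => by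
    have hl : HasDerivAt (fun t : ℝ => a + t • v) v t := by
      simpa using ((hasDerivAt_id t).smul_const v).const_add a
    have hc := (hball _ (hseg t ht)).2.hasFDerivAt.comp_hasDerivAt t hl
    have h5 := (hasDerivAt_id t).mul_const (fderiv ℝ f a v)
    have h6 := (((hasDerivAt_id t).pow 2).div_const 2).mul_const (H v v)
    have := (hc.sub h5).sub h6
    refine (this.congr_deriv ?_).hasDerivWithinAt
    simp
  have hbound := norm_image_sub_le_of_norm_deriv_le_segment_01' (C := δ * ‖v‖ ^ 2) hder
    (fun t ht => by
      have h7 := h2 _ (hball _ (hseg t ⟨ht.1, ht.2.le⟩)).1 _ (hball a ha).1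
      simp only [add_sub_cancel_left, map_smul] at h7
      have h8 := ((fderiv ℝ f (a + t • v) - fderiv ℝ f a - t • H v).le_opNorm v).trans
        (mul_le_mul_of_nonneg_right h7 (norm_nonneg v))
      simp only [sub_apply, smul_apply, smul_eq_mul] at h8
      refine h8.trans ?_
      rw [norm_smul, Real.norm_of_nonneg ht.1]
      have : 0 ≤ δ * ‖v‖ ^ 2 := by positivity
      nlinarith [ht.2])
  rw [Real.norm_eq_abs] at hbound
  refine le_of_eq_of_le (congrArg _ ?_) hbound
  simp only [bregman, hv, one_smul, zero_smul, add_zero, add_sub_cancel]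
  ring

lemma exists_pos_mul_norm_sq_le {E : Type*} [NormedAddCommGroup E] [NormedSpace ℝ E]
    [FiniteDimensional ℝ E] (H : E →L[ℝ] E →L[ℝ] ℝ) (hH : ∀ v ≠ 0, 0 < H v v) :
    ∃ c > 0, ∀ v, c * ‖v‖ ^ 2 ≤ H v v := by
  rcases (sphere (0 : E) 1).eq_empty_or_nonempty with he | hne
  · refine ⟨1, one_pos, fun v => ?_⟩
    have : v = 0 := by
      by_contra hv
      have : (‖v‖⁻¹ • v) ∈ sphere (0 : E) 1 := by
        simp [norm_smul, hv]
      simp [he] at this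
    simp [this]
  · obtain ⟨w, hw, hmin⟩ := (isCompact_sphere (0 : E) 1).exists_isMinOn hne
      (f := fun v => H v v) (by fun_prop)
    have hw0 : w ≠ 0 := by
      rintro rfl
      simp at hw
    refine ⟨H w w, hH w hw0, fun v => ?_⟩
    by_cases hv : v = 0
    · simp [hv]
    have h1 : H w w ≤ H (‖v‖⁻¹ • v) (‖v‖⁻¹ • v) := hmin (by simp [norm_smul, hv])
    have hp : 0 < ‖v‖ := norm_pos_iff.2 hv
    simp only [map_smul, smul_apply, smul_eq_mul] at h1
    calc H w w * ‖v‖ ^ 2 ≤ ‖v‖⁻¹ * (‖v‖⁻¹ * H v v) * ‖v‖ ^ 2 := by gcongr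
      _ = H v v := by field_simp

/-- A positive semidefinite Hessian with nonzero determinant is positive definite. -/
lemma hessian_pos_of_nonneg_of_det {m : ℕ} {f : Euc m → ℝ} {z : Euc m} (hf : ContDiffAt ℝ 2 f z)
    (h0 : ∀ v, 0 ≤ fderiv ℝ (fderiv ℝ f) z v v)
    (hdet : (Matrix.of fun i j : Fin m => iteratedFDeriv ℝ 2 f z
      ![EuclideanSpace.single i 1, EuclideanSpace.single j 1]).det ≠ 0) :
    ∀ v ≠ 0, 0 < fderiv ℝ (fderiv ℝ f) z v v := by
  set A : Matrix (Fin m) (Fin m) ℝ := Matrix.of fun i j : Fin m => iteratedFDeriv ℝ 2 f z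
      ![EuclideanSpace.single i 1, EuclideanSpace.single j 1] with hA
  have hAij : ∀ i j, A i j = fderiv ℝ (fderiv ℝ f) z
      (EuclideanSpace.single i 1) (EuclideanSpace.single j 1) := fun i j => by
    simp [hA, iteratedFDeriv_two_apply]
  have hq : ∀ v : Euc m, star v.ofLp ⬝ᵥ A.mulVec v.ofLp = fderiv ℝ (fderiv ℝ f) z v v := by
    intro v
    have hv : v = ∑ i, v i • EuclideanSpace.single i (1 : ℝ) := by
      ext j
      simp [Finset.sum_apply, Pi.single_apply]
    conv_rhs => rw [hv]
    simp only [map_sum, map_smul, sum_apply, smul_apply,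
      smul_eq_mul, dotProduct, Matrix.mulVec, hAij, Finset.mul_sum]
    rw [Finset.sum_comm]
    refine Finset.sum_congr rfl fun i _ => Finset.sum_congr rfl fun j _ => ?_
    simp
    ring
  have hherm : A.IsHermitian := by
    ext i j
    simp only [Matrix.conjTranspose_apply, hAij, star_trivial]
    exact (hf.isSymmSndFDerivAt (by simp)) _ _
  have hpsd : A.PosSemidef := Matrix.PosSemidef.of_dotProduct_mulVec_nonneg hherm fun x => by
    rw [show x = (WithLp.toLp 2 x : Euc m).ofLp from rfl, hq]
    exact h0 _
  have hpd := hpsd.posDef_iff_det_ne_zero.2 hdet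
  intro v hv
  rw [← hq]
  exact hpd.dotProduct_mulVec_pos (by simpa using hv)

lemma hessian_nonneg_of_isLocalMin {E : Type*} [NormedAddCommGroup E] [NormedSpace ℝ E]
    {f : E → ℝ} {z : E} (hf : ContDiffAt ℝ 2 f z) (hmin : IsLocalMin f z) (v : E) :
    0 ≤ fderiv ℝ (fderiv ℝ f) z v v := by
  refine le_of_forall_pos_lt_add fun e he => ?_
  obtain ⟨δ, hδ, hδe⟩ : ∃ δ > 0, 2 * δ * ‖v‖ ^ 2 < e := by
    refine ⟨e / (4 * (‖v‖ ^ 2 + 1)), by positivity, ?_⟩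
    have : 0 < ‖v‖ ^ 2 + 1 := by positivity
    rw [show 2 * (e / (4 * (‖v‖ ^ 2 + 1))) * ‖v‖ ^ 2 = e * (‖v‖ ^ 2 / (2 * (‖v‖ ^ 2 + 1))) by
      field_simp; ring]
    refine mul_lt_of_lt_one_right he ?_
    rw [div_lt_one (by positivity)]
    nlinarith [sq_nonneg ‖v‖]
  obtain ⟨r, hr, h⟩ := exists_ball_abs_bregman_sub_le hf hδ
  have hl : Tendsto (fun t : ℝ => z + t • v) (𝓝[>] 0) (𝓝 z) := by
    have : Continuous fun t : ℝ => z + t • v := by fun_prop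
    simpa using (this.tendsto 0).mono_left nhdsWithin_le_nhds
  obtain ⟨t, ⟨ht1, ht2⟩, ht⟩ := ((hl.eventually (ball_mem_nhds z hr)).and
    (hl.eventually hmin) |>.and self_mem_nhdsWithin).exists
  have ht : (0 : ℝ) < t := ht
  have h1 := h z (mem_ball_self hr) _ ht1
  simp only [bregman, hmin.fderiv_eq_zero, add_sub_cancel_left, map_smul,
    smul_apply, smul_eq_mul, norm_smul, Real.norm_of_nonneg ht.le,
    zero_apply] at h1
  have h2 := (abs_le.1 h1).1
  have h2' := (abs_le.1 h1).2
  set X := fderiv ℝ (fderiv ℝ f) z v v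
  have h3 : 0 ≤ t ^ 2 * (2 * δ * ‖v‖ ^ 2 + X) := by nlinarith
  have h4 := nonneg_of_mul_nonneg_right h3 (by positivity)
  linarith

lemma exists_ball_bregman_pos {E : Type*} [NormedAddCommGroup E] [NormedSpace ℝ E]
    [FiniteDimensional ℝ E] {f : E → ℝ} {z : E} (hf : ContDiffAt ℝ 2 f z)
    (hz : fderiv ℝ f z = 0) (hH : ∀ v ≠ 0, 0 < fderiv ℝ (fderiv ℝ f) z v v)
    {η : ℝ} (hη : 0 < η) (hη1 : η < 1) :
    ∃ r > 0, (∀ a ∈ ball z r, ‖fderiv ℝ f a‖ ≤ η ∧ DifferentiableAt ℝ f a) ∧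
      ∀ a ∈ ball z r, ∀ b ∈ ball z r,
        (a ≠ b → 0 < bregman f a b) ∧ (1 - η) * bregman f a b ≤ bregman f b a := by
  obtain ⟨c, hc, hcH⟩ := exists_pos_mul_norm_sq_le _ hH
  obtain ⟨r₁, hr₁, h₁⟩ := exists_ball_abs_bregman_sub_le hf (δ := η * c / 4) (by positivity)
  have h3 : ∀ᶠ y in 𝓝 z, DifferentiableAt ℝ f y :=
    (hf.eventually (by norm_num)).mono fun y hy => hy.differentiableAt (by norm_num)
  have h4 : ∀ᶠ y in 𝓝 z, ‖fderiv ℝ f y‖ < η := by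
    have : ContinuousAt (fun y => ‖fderiv ℝ f y‖) z :=
      (hf.fderiv_right (m := 1) (by norm_num)).continuousAt.norm
    exact this.eventually_lt_const (by simpa [hz] using hη)
  obtain ⟨r₂, hr₂, h₂⟩ := Metric.eventually_nhds_iff_ball.1 (h4.and h3)
  refine ⟨min r₁ r₂, lt_min hr₁ hr₂, fun a ha => ?_, fun a ha b hb => ?_⟩
  · have := h₂ a (ball_subset_ball (min_le_right _ _) ha)
    exact ⟨this.1.le, this.2⟩
  have ha' := ball_subset_ball (min_le_left r₁ r₂) ha
  have hb' := ball_subset_ball (min_le_left r₁ r₂) hb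
  have hab := abs_le.1 (h₁ a ha' b hb')
  have hba := abs_le.1 (h₁ b hb' a ha')
  have hsym : fderiv ℝ (fderiv ℝ f) z (a - b) (a - b)
      = fderiv ℝ (fderiv ℝ f) z (b - a) (b - a) := by
    rw [← neg_sub b a, map_neg, map_neg, neg_apply, neg_neg]
  rw [hsym, norm_sub_rev a b] at hba
  have hcab := hcH (b - a)
  set h := fderiv ℝ (fderiv ℝ f) z (b - a) (b - a)
  set N := ‖b - a‖ ^ 2
  have hN : 0 ≤ c * N := by positivity
  have hηN : 0 ≤ η * (c * N) := by positivity
  constructor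
  · intro hne
    have : 0 < N := by
      have : b - a ≠ 0 := sub_ne_zero.2 hne.symm
      positivity
    have : 0 < c * N := by positivity
    nlinarith
  · nlinarith [mul_le_mul_of_nonneg_left hcab hη.le,
      mul_le_mul_of_nonneg_left hab.2 (sub_nonneg.2 hη1.le), mul_nonneg hη.le hηN]

lemma exists_eq_map_add_smul {n : ℕ} (hn : 1 ≤ n) (L : Euc (n - 1) →ₗᵢ[ℝ] Euc n) {ν₀ : Euc n}
    (hν₀ : ‖ν₀‖ = 1) (hL : ∀ v, ⟪L v, ν₀⟫ = 0) (ν : Euc n) : ∃ q, ν = L q + ⟪ν, ν₀⟫ • ν₀ := by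
  let T : Euc (n - 1) × ℝ →ₗ[ℝ] Euc n :=
    L.toLinearMap.coprod (LinearMap.toSpanSingleton ℝ _ ν₀)
  have hT : ∀ p, T p = L p.1 + p.2 • ν₀ := fun p => by simp [T]
  have hin : ∀ p, ⟪T p, ν₀⟫ = p.2 := fun p => by
    rw [hT, inner_add_left, hL, inner_smul_left, real_inner_self_eq_norm_sq, hν₀]
    simp
  have hinj : Function.Injective T := by
    refine (injective_iff_map_eq_zero T).2 fun p hp => ?_
    have h2 : p.2 = 0 := by rw [← hin, hp, inner_zero_left]
    have h1 : L p.1 = 0 := by simpa [hT, h2] using hp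
    exact Prod.ext (L.injective (by simpa using h1)) h2
  obtain ⟨p, hp⟩ := (LinearMap.injective_iff_surjective_of_finrank_eq_finrank
    (by simp; omega)).1 hinj ν
  refine ⟨p.1, ?_⟩
  rw [← hp, hin, hT]

lemma inner_chart_eq {n : ℕ} {S : Set (Euc n)} (hS : IsClosed S) {x₀ ν₀ : Euc n}
    {L : Euc (n - 1) →ₗᵢ[ℝ] Euc n} {f : Euc (n - 1) → ℝ} {τ ρ : ℝ}
    (hchart : frontier S ∩ ball x₀ ρ
      = {y | ∃ v ∈ ball (0 : Euc (n-1)) τ, y = x₀ + L v - f v • ν₀} ∩ ball x₀ ρ)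
    {b : Euc (n - 1)} (hb : b ∈ ball 0 τ) (hbρ : x₀ + L b - f b • ν₀ ∈ ball x₀ ρ)
    (hf : DifferentiableAt ℝ f b) {ν : Euc n} (hν : IsOuterNormalAt S (x₀ + L b - f b • ν₀) ν)
    (d : Euc (n - 1)) : ⟪L d, ν⟫ = ⟪ν₀, ν⟫ * fderiv ℝ f b d := by
  have hcont : ContinuousAt (fun v => x₀ + L v - f v • ν₀) b := by
    have := hf.continuousAt
    fun_prop
  have hmax : IsLocalMax (fun v => ⟪ν, L v⟫ - ⟪ν₀, ν⟫ * f v) b := by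
    filter_upwards [isOpen_ball.mem_nhds hb, hcont (isOpen_ball.mem_nhds hbρ)] with v hv hvρ
    have hmem : x₀ + L v - f v • ν₀ ∈ S :=
      hS.frontier_subset (hchart.symm.subset ⟨⟨v, hv, rfl⟩, hvρ⟩).1
    have := hν.2 _ hmem
    simp only [inner_sub_left, inner_add_left, inner_smul_left, RCLike.conj_to_real] at this
    rw [real_inner_comm (L v) ν, real_inner_comm (L b) ν]
    linarith
  have hd : HasFDerivAt (fun v => ⟪ν, L v⟫ - ⟪ν₀, ν⟫ * f v)
      ((innerSL ℝ ν).comp L.toContinuousLinearMap - ⟪ν₀, ν⟫ • fderiv ℝ f b) b :=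
    ((innerSL ℝ ν).comp L.toContinuousLinearMap).hasFDerivAt.sub
      (hf.hasFDerivAt.const_mul _)
  have h0 := congrArg (fun F => F d) (hmax.hasFDerivAt_eq_zero hd)
  simp only [sub_apply, smul_apply, zero_apply, smul_eq_mul, ContinuousLinearMap.comp_apply,
    innerSL_apply_apply, LinearIsometry.coe_toContinuousLinearMap] at h0
  rw [real_inner_comm]
  linarith

lemma isLocalMin_chart {n : ℕ} {S : Set (Euc n)} (hS : IsClosed S) {x₀ ν₀ : Euc n}
    {L : Euc (n - 1) →ₗᵢ[ℝ] Euc n} {f : Euc (n - 1) → ℝ} {τ ρ : ℝ} (hτ : 0 < τ) (hρ : 0 < ρ)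
    (hL : ∀ v, ⟪L v, ν₀⟫ = 0) (hf : ContinuousAt f 0) (hf0 : f 0 = 0)
    (hchart : frontier S ∩ ball x₀ ρ
      = {y | ∃ v ∈ ball (0 : Euc (n-1)) τ, y = x₀ + L v - f v • ν₀} ∩ ball x₀ ρ)
    (hν₀ : IsOuterNormalAt S x₀ ν₀) : IsLocalMin f 0 := by
  have hcont : Tendsto (fun v => x₀ + L v - f v • ν₀) (𝓝 0) (𝓝 x₀) := by
    have : ContinuousAt (fun v => x₀ + L v - f v • ν₀) 0 := by fun_prop
    simpa [ContinuousAt, hf0] using this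
  filter_upwards [ball_mem_nhds 0 hτ, hcont (ball_mem_nhds x₀ hρ)] with v hv hvρ
  have hmem : x₀ + L v - f v • ν₀ ∈ S :=
    hS.frontier_subset (hchart.symm.subset ⟨⟨v, hv, rfl⟩, hvρ⟩).1
  have := hν₀.2 _ hmem
  rw [inner_sub_left, inner_add_left, hL, inner_smul_left, real_inner_self_eq_norm_sq,
    hν₀.1] at this
  simp only [RCLike.conj_to_real] at this
  rw [hf0]
  linarith

lemma one_le_mul_abs_inner {n : ℕ} (hn : 1 ≤ n) (L : Euc (n - 1) →ₗᵢ[ℝ] Euc n) {ν₀ ν : Euc n}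
    (hν₀ : ‖ν₀‖ = 1) (hL : ∀ v, ⟪L v, ν₀⟫ = 0) (hν : ‖ν‖ = 1) {φ : Euc (n - 1) →L[ℝ] ℝ} {η : ℝ}
    (hφ : ‖φ‖ ≤ η) (h : ∀ d, ⟪L d, ν⟫ = ⟪ν₀, ν⟫ * φ d) : 1 ≤ (1 + η) * |⟪ν₀, ν⟫| := by
  obtain ⟨q, hq⟩ := exists_eq_map_add_smul hn L hν₀ hL ν
  have hqq : ‖q‖ ^ 2 = ⟪L q, ν⟫ := by
    rw [hq, inner_add_right, inner_smul_right, hL, real_inner_self_eq_norm_sq, L.norm_map]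
    simp
  have hle : ‖q‖ ≤ η * |⟪ν₀, ν⟫| := by
    have h1 : ‖q‖ ^ 2 ≤ |⟪ν₀, ν⟫| * (η * ‖q‖) := by
      rw [hqq, h]
      refine (le_abs_self _).trans ?_
      rw [abs_mul]
      gcongr
      exact (φ.le_opNorm q).trans (by gcongr)
    rcases (norm_nonneg q).eq_or_lt with h0 | h0
    · rw [← h0]
      have := (norm_nonneg φ).trans hφ
      positivity
    · refine le_of_mul_le_mul_right ?_ h0
      linarith
  have h2 : ‖ν‖ ≤ ‖L q‖ + ‖⟪ν, ν₀⟫ • ν₀‖ := by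
    conv_lhs => rw [hq]
    exact norm_add_le _ _
  rw [hν, L.norm_map, norm_smul, hν₀, mul_one, Real.norm_eq_abs, real_inner_comm] at h2
  linarith

/-- Near a point of positive curvature the boundary is strictly convex, and a boundary point
lying deeper than `(1 + ε) Δ` below `x` is not visible from `x + Δ μ`. -/
lemma exists_ball_inner_neg {n : ℕ} (hn : 1 ≤ n) {S : Set (Euc n)} (hS : IsClosed S)
    {x₀ ν₀ : Euc n} {k : ℝ} (hν₀ : IsOuterNormalAt S x₀ ν₀) (hk : IsGaussCurvatureAt S x₀ ν₀ k)
    (hk0 : 0 < k) {ε : ℝ} (hε : 0 < ε) :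
    ∃ r > 0, ∀ x ∈ frontier S ∩ ball x₀ r, ∀ w ∈ frontier S ∩ ball x₀ r, ∀ μ ν,
      IsOuterNormalAt S x μ → IsOuterNormalAt S w ν →
        (x ≠ w → ⟪x - w, ν⟫ < 0) ∧
        ∀ Δ, 0 ≤ Δ → ⟪w - x, μ⟫ < -((1 + ε) * Δ) → ⟪x + Δ • μ - w, ν⟫ < 0 := by
  obtain ⟨L, f, τ, ρ, hτ, hρ, hL, hfC, hf0, hdf0, hchart, hdet⟩ := hk
  have hf2 : ContDiffAt ℝ 2 f 0 := hfC.contDiffAt (ball_mem_nhds 0 hτ)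
  have hpos := hessian_pos_of_nonneg_of_det hf2
    (hessian_nonneg_of_isLocalMin hf2
      (isLocalMin_chart hS hτ hρ hL hf2.continuousAt hf0 hchart hν₀)) (hdet ▸ hk0.ne')
  set η := ε / (2 + ε) with hη
  have hη0 : 0 < η := by positivity
  have hη1 : η < 1 := by rw [hη, div_lt_one (by positivity)]; linarith
  have hηε : (1 - η) * (1 + ε) = 1 + η := by rw [hη]; field_simp; ring
  obtain ⟨r, hr, hr1, hr2⟩ := exists_ball_bregman_pos hf2 hdf0 hpos hη0 hη1
  refine ⟨min r ρ, lt_min hr hρ, ?_⟩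
  have hcoord : ∀ y ∈ frontier S ∩ ball x₀ (min r ρ), ∃ v ∈ ball (0 : Euc (n - 1)) r,
      y = x₀ + L v - f v • ν₀ ∧ ∀ ν, IsOuterNormalAt S y ν →
        ∀ d, ⟪L d, ν⟫ = ⟪ν₀, ν⟫ * fderiv ℝ f v d := by
    intro y hy
    have hyρ := ball_subset_ball (min_le_right r ρ) hy.2
    obtain ⟨⟨v, hv, rfl⟩, -⟩ := hchart.subset ⟨hy.1, hyρ⟩
    have hvr : v ∈ ball (0 : Euc (n - 1)) r := by
      have h1 : ‖x₀ + L v - f v • ν₀ - x₀‖ < r :=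
        (mem_ball_iff_norm.1 hy.2).trans_le (min_le_left _ _)
      have h2 : ‖v‖ ^ 2 = ⟪L v, x₀ + L v - f v • ν₀ - x₀⟫ := by
        rw [show x₀ + L v - f v • ν₀ - x₀ = L v - f v • ν₀ by abel, inner_sub_right,
          inner_smul_right, hL, real_inner_self_eq_norm_sq, L.norm_map]
        simp
      have h3 := real_inner_le_norm (L v) (x₀ + L v - f v • ν₀ - x₀)
      rw [← h2, L.norm_map] at h3
      rw [mem_ball_zero_iff]
      nlinarith [norm_nonneg v]
    exact ⟨v, hvr, rfl, fun ν hν d => inner_chart_eq hS hchart hv hyρ (hr1 v hvr).2 hν d⟩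
  have hdiff : ∀ a b : Euc (n - 1), ∀ ν : Euc n,
      (∀ d, ⟪L d, ν⟫ = ⟪ν₀, ν⟫ * fderiv ℝ f b d) →
      ⟪x₀ + L a - f a • ν₀ - (x₀ + L b - f b • ν₀), ν⟫ = -(⟪ν₀, ν⟫ * bregman f b a) := by
    intro a b ν h
    have h1 := h (a - b)
    rw [show x₀ + L a - f a • ν₀ - (x₀ + L b - f b • ν₀) = L (a - b) - (f a - f b) • ν₀ by
      rw [map_sub, sub_smul]; abel, inner_sub_left, inner_smul_left, h1, bregman]
    simp only [RCLike.conj_to_real]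
    ring
  intro x hx w hw μ ν hμ hν
  obtain ⟨a, ha, rfl, hxa⟩ := hcoord x hx
  obtain ⟨b, hb, rfl, hwb⟩ := hcoord w hw
  have hσ := one_le_mul_abs_inner hn L hν₀.1 hL hν.1 (hr1 b hb).1 (hwb ν hν)
  have hxw := hdiff a b ν (hwb ν hν)
  have hle : ⟪x₀ + L a - f a • ν₀ - (x₀ + L b - f b • ν₀), ν⟫ ≤ 0 := by
    rw [inner_sub_left]
    exact sub_nonpos.2 (hν.2 _ (hS.frontier_subset hx.1))
  have hne : ⟪ν₀, ν⟫ ≠ 0 := by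
    intro h
    rw [h] at hσ
    norm_num at hσ
  have hσpos : a ≠ b → 0 < ⟪ν₀, ν⟫ := fun hab => by
    have := (hr2 b hb a ha).1 hab.symm
    rw [hxw] at hle
    refine lt_of_le_of_ne ?_ hne.symm
    exact nonneg_of_mul_nonneg_left (by linarith) this
  constructor
  · intro hxw'
    have hab : a ≠ b := by
      rintro rfl
      exact hxw' rfl
    rw [hxw]
    exact neg_neg_of_pos (mul_pos (hσpos hab) ((hr2 b hb a ha).1 hab.symm))
  · intro Δ hΔ hlt
    rw [hdiff b a μ (hxa μ hμ)] at hlt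
    have hεΔ : 0 ≤ (1 + ε) * Δ := by positivity
    have hab : a ≠ b := by
      rintro rfl
      have : bregman f a a = 0 := by simp [bregman]
      rw [this] at hlt
      linarith
    have hF := (hr2 a ha b hb).1 hab
    have hs : ⟪ν₀, μ⟫ ≤ 1 := by
      simpa [hν₀.1, hμ.1] using real_inner_le_norm ν₀ μ
    have hFa : (1 + ε) * Δ < bregman f a b := by nlinarith
    have hFb : (1 + η) * Δ < bregman f b a := by
      have := (hr2 a ha b hb).2
      rw [← hηε]
      nlinarith [mul_lt_mul_of_pos_left hFa (sub_pos.2 hη1)]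
    have hσ0 := hσpos hab
    rw [abs_of_pos hσ0] at hσ
    have hμν : ⟪μ, ν⟫ ≤ 1 := by
      simpa [hν.1, hμ.1] using real_inner_le_norm μ ν
    rw [add_sub_right_comm, inner_add_left, hxw, inner_smul_left]
    simp only [RCLike.conj_to_real]
    nlinarith [mul_lt_mul_of_pos_left hFb hσ0, mul_le_mul_of_nonneg_left hμν hΔ,
      mul_le_mul_of_nonneg_right hσ hΔ]

lemma IsOuterNormalAt.mem_frontier {n : ℕ} {S : Set (Euc n)} {x ν : Euc n}
    (h : IsOuterNormalAt S x ν) (hx : x ∈ S) : x ∈ frontier S := by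
  refine ⟨subset_closure hx, fun hint => ?_⟩
  have hl : Tendsto (fun t : ℝ => x + t • ν) (𝓝[>] 0) (𝓝 x) := by
    have : Continuous fun t : ℝ => x + t • ν := by fun_prop
    simpa using (this.tendsto 0).mono_left nhdsWithin_le_nhds
  obtain ⟨t, ht, ht0⟩ := ((hl.eventually (mem_interior_iff_mem_nhds.1 hint)).and
    self_mem_nhdsWithin).exists
  have ht0 : (0 : ℝ) < t := ht0
  have := h.2 _ ht
  rw [inner_add_left, inner_smul_left, real_inner_self_eq_norm_sq, h.1] at this
  simp only [RCLike.conj_to_real] at this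
  linarith

lemma exists_isOuterNormalAt_inner_nonneg {n : ℕ} {S : Set (Euc n)} (hconv : Convex ℝ S)
    (hint : (interior S).Nonempty) {w p : Euc n} (hw : w ∈ S)
    (hp : ∀ t ∈ Ioc (0 : ℝ) 1, AffineMap.lineMap w p t ∉ S) :
    ∃ ν, IsOuterNormalAt S w ν ∧ 0 ≤ ⟪p - w, ν⟫ := by
  have hw' : w ∉ interior S := by
    intro h
    have hl : Tendsto (fun t : ℝ => AffineMap.lineMap w p t) (𝓝[>] 0) (𝓝 w) := by
      have : Continuous fun t : ℝ => AffineMap.lineMap w p t := AffineMap.lineMap_continuous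
      simpa using (this.tendsto 0).mono_left nhdsWithin_le_nhds
    obtain ⟨t, ht, ht0⟩ := ((hl.eventually (mem_interior_iff_mem_nhds.1 h)).and
      (Ioc_mem_nhdsGT one_pos)).exists
    exact hp t ht0 ht
  have hdisj : Disjoint (interior S) (segment ℝ w p) := by
    rw [Set.disjoint_right]
    intro q hq hqS
    rw [segment_eq_image_lineMap] at hq
    obtain ⟨t, ht, rfl⟩ := hq
    rcases ht.1.eq_or_lt with rfl | h0
    · exact hw' (by simpa using hqS)
    · exact hp t ⟨h0, ht.2⟩ (interior_subset hqS)
  obtain ⟨g, c, hgS, hgp⟩ := geometric_hahn_banach_open hconv.interior isOpen_interior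
    (convex_segment w p) hdisj
  have hcl : ∀ y ∈ S, g y ≤ c := by
    intro y hy
    have hy' : y ∈ closure (interior S) := by
      rw [hconv.closure_interior_eq_closure_of_nonempty_interior hint]
      exact subset_closure hy
    exact closure_minimal (fun z hz => (hgS z hz).le)
      (isClosed_le g.continuous continuous_const) hy'
  have hgw : g w = c := (hcl w hw).antisymm (hgp w (left_mem_segment ℝ w p))
  set m := (InnerProductSpace.toDual ℝ (Euc n)).symm g with hm
  have hg : ∀ y, ⟪y, m⟫ = g y := fun y => by
    rw [real_inner_comm, hm, InnerProductSpace.toDual_symm_apply]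
  have hm0 : m ≠ 0 := by
    intro h0
    obtain ⟨z, hz⟩ := hint
    have := hgS z hz
    rw [← hgw, ← hg, ← hg, h0] at this
    simp at this
  have hmpos : 0 < ‖m‖ := norm_pos_iff.2 hm0
  refine ⟨‖m‖⁻¹ • m, ⟨by simp [norm_smul, hm0], fun y hy => ?_⟩, ?_⟩
  · rw [inner_smul_right, inner_smul_right, hg, hg, hgw]
    exact mul_le_mul_of_nonneg_left (hcl y hy) (by positivity)
  · rw [inner_smul_right, inner_sub_left, hg, hg, hgw]
    exact mul_nonneg (by positivity) (sub_nonneg.2 (hgp p (right_mem_segment ℝ w p)))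

/-- A supporting hyperplane of a `C²₊` body touches it in a single point. -/
lemma IsC2Body.eq_of_inner_nonneg {n : ℕ} (hn : 1 ≤ n) {S : Set (Euc n)} (hcl : IsClosed S)
    (hconv : Convex ℝ S) {u : Euc n → Euc n} {κ : Euc n → ℝ} (hC2 : IsC2Body S u κ)
    (hκ : ∀ x ∈ frontier S, 0 < κ x) {x w ν : Euc n} (hx : x ∈ S) (hw : w ∈ S)
    (hν : IsOuterNormalAt S w ν) (h : 0 ≤ ⟪x - w, ν⟫) : x = w := by
  by_contra hne
  have hwf := hν.mem_frontier hw
  obtain ⟨r, hr, hloc⟩ := exists_ball_inner_neg hn hcl (hC2 w hwf).1 (hC2 w hwf).2 (hκ w hwf)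
    one_pos
  have hl : Tendsto (fun t : ℝ => w + t • (x - w)) (𝓝[>] 0) (𝓝 w) := by
    have : Continuous fun t : ℝ => w + t • (x - w) := by fun_prop
    simpa using (this.tendsto 0).mono_left nhdsWithin_le_nhds
  obtain ⟨t, htr, ht⟩ := ((hl.eventually (ball_mem_nhds w hr)).and
    (Ioc_mem_nhdsGT one_pos)).exists
  set m := w + t • (x - w) with hm
  have hmS : m ∈ S := hconv.add_smul_sub_mem hw hx ⟨ht.1.le, ht.2⟩
  have hmw : 0 ≤ ⟪m - w, ν⟫ := by
    rw [hm, add_sub_cancel_left, inner_smul_left]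
    exact mul_nonneg ht.1.le h
  have hmν : IsOuterNormalAt S m ν := by
    refine ⟨hν.1, fun y hy => (hν.2 y hy).trans ?_⟩
    rw [inner_sub_left] at hmw
    linarith
  have hmne : m ≠ w := by
    simp [hm, ht.1.ne', sub_eq_zero, hne]
  have := (hloc m ⟨hmν.mem_frontier hmS, htr⟩ w ⟨hwf, mem_ball_self hr⟩ ν ν hmν hν).1 hmne
  linarith

lemma IsC2Body.exists_forall_inner_neg {n : ℕ} (hn : 1 ≤ n) {S : Set (Euc n)} (hcpt : IsCompact S)
    (hconv : Convex ℝ S) {u : Euc n → Euc n} {κ : Euc n → ℝ} (hC2 : IsC2Body S u κ)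
    (hκ : ∀ x ∈ frontier S, 0 < κ x) {ε : ℝ} (hε : 0 < ε) :
    ∃ Δ₀ > 0, ∀ Δ, 0 ≤ Δ → Δ ≤ Δ₀ → ∀ x ∈ frontier S, ∀ w ∈ frontier S, ∀ ν,
      IsOuterNormalAt S w ν → ⟪w - x, u x⟫ < -((1 + ε) * Δ) →
        ⟪x + Δ • u x - w, ν⟫ < 0 := by
  by_contra! hcon
  choose Δ hΔ0 hΔk x hx w hw ν hν hlow hvis using
    fun k : ℕ => hcon (1 / ((k : ℝ) + 1)) (by positivity)
  have hΔ : Tendsto Δ atTop (𝓝 0) :=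
    squeeze_zero hΔ0 hΔk tendsto_one_div_add_atTop_nhds_zero_nat
  have hcl := hcpt.isClosed
  have hfr : IsCompact (frontier S) := hcpt.of_isClosed_subset isClosed_frontier hcl.frontier_subset
  obtain ⟨⟨x₀, w₀, ν₀⟩, ⟨hx₀, hw₀, hν₀⟩, φ, hφ, hlim⟩ :=
    (hfr.prod (hfr.prod (isCompact_sphere (0 : Euc n) 1))).tendsto_subseq
      (x := fun k => (x k, w k, ν k)) fun k => ⟨hx k, hw k, by simpa using (hν k).1⟩
  have hlx : Tendsto (fun k => x (φ k)) atTop (𝓝 x₀) := (continuous_fst.tendsto _).comp hlim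
  have hlw : Tendsto (fun k => w (φ k)) atTop (𝓝 w₀) :=
    ((continuous_fst.comp continuous_snd).tendsto _).comp hlim
  have hlν : Tendsto (fun k => ν (φ k)) atTop (𝓝 ν₀) :=
    ((continuous_snd.comp continuous_snd).tendsto _).comp hlim
  have hlΔ : Tendsto (fun k => Δ (φ k)) atTop (𝓝 0) := hΔ.comp hφ.tendsto_atTop
  have hnormal : IsOuterNormalAt S w₀ ν₀ :=
    ⟨by simpa using hν₀, fun y hy => le_of_tendsto_of_tendsto' (tendsto_const_nhds.inner hlν)
      (hlw.inner hlν) fun k => (hν (φ k)).2 y hy⟩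
  have hlim0 : 0 ≤ ⟪x₀ - w₀, ν₀⟫ := by
    have h1 : Tendsto (fun k => Δ (φ k) + ⟪x (φ k) - w (φ k), ν (φ k)⟫) atTop
        (𝓝 (0 + ⟪x₀ - w₀, ν₀⟫)) := hlΔ.add ((hlx.sub hlw).inner hlν)
    rw [zero_add] at h1
    refine ge_of_tendsto' h1 fun k => ?_
    have h2 := hvis (φ k)
    rw [add_sub_right_comm, inner_add_left, inner_smul_left] at h2
    have h3 : ⟪u (x (φ k)), ν (φ k)⟫ ≤ 1 := by
      simpa [(hν (φ k)).1, (hC2 _ (hx (φ k))).1.1] using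
        real_inner_le_norm (u (x (φ k))) (ν (φ k))
    have h4 := mul_le_mul_of_nonneg_left h3 (hΔ0 (φ k))
    simp only [RCLike.conj_to_real] at h2
    linarith
  have hxw : x₀ = w₀ := hC2.eq_of_inner_nonneg hn hcl hconv hκ (hcl.frontier_subset hx₀)
    (hcl.frontier_subset hw₀) hnormal hlim0
  subst hxw
  obtain ⟨r, hr, hloc⟩ := exists_ball_inner_neg hn hcl (hC2 x₀ hx₀).1 (hC2 x₀ hx₀).2 (hκ x₀ hx₀) hε
  obtain ⟨k, hkx, hkw⟩ := ((hlx.eventually (ball_mem_nhds x₀ hr)).and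
    (hlw.eventually (ball_mem_nhds x₀ hr))).exists
  exact absurd ((hloc _ ⟨hx _, hkx⟩ _ ⟨hw _, hkw⟩ _ _ (hC2 _ (hx _)).1 (hν (φ k))).2 _ (hΔ0 _)
    (hlow (φ k))) (not_lt.2 (hvis (φ k)))

/-- The affine functional `ξ ↦ ⟪ξ - x, ν⟫` along a segment. -/
lemma inner_lineMap_sub {n : ℕ} (x ν y p : Euc n) (t : ℝ) :
    ⟪AffineMap.lineMap y p t - x, ν⟫ = ⟪y - x, ν⟫ + t * (⟪p - x, ν⟫ - ⟪y - x, ν⟫) := by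
  rw [AffineMap.lineMap_apply_module', ← inner_sub_left, sub_sub_sub_cancel_right, add_sub_assoc,
    inner_add_left, inner_smul_left]
  simp only [RCLike.conj_to_real]
  ring

/-- If no boundary point below the level `c` is visible from `p`, then the segment from a point
`y` of `S` below that level to `p` leaves `S` at a level at least `c`. -/
lemma lineMap_mem_of_forall_inner_neg {n : ℕ} {S : Set (Euc n)} (hcl : IsClosed S)
    (hconv : Convex ℝ S) (hint : (interior S).Nonempty) {x ν₀ p : Euc n} {c : ℝ}
    (hvis : ∀ w ∈ frontier S, ∀ ν, IsOuterNormalAt S w ν → ⟪w - x, ν₀⟫ < c → ⟪p - w, ν⟫ < 0)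
    {y : Euc n} (hy : y ∈ S) (hyp : ⟪y - x, ν₀⟫ < ⟪p - x, ν₀⟫) {t : ℝ} (ht : t ∈ Icc (0 : ℝ) 1)
    (htc : ⟪AffineMap.lineMap y p t - x, ν₀⟫ ≤ c) : AffineMap.lineMap y p t ∈ S := by
  have hcont : Continuous fun s : ℝ => AffineMap.lineMap y p s := AffineMap.lineMap_continuous
  have hord : OrdConnected ((fun s : ℝ => AffineMap.lineMap y p s) ⁻¹' S) :=
    (hconv.affine_preimage (AffineMap.lineMap y p)).ordConnected
  have h0 : (0 : ℝ) ∈ (fun s : ℝ => AffineMap.lineMap y p s) ⁻¹' S := by simpa using hy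
  obtain ⟨s, ⟨hs, hsS⟩, hmax⟩ :=
    (isCompact_Icc.inter_right (hcl.preimage hcont)).exists_isGreatest
      (s := Icc (0 : ℝ) 1 ∩ (fun s : ℝ => AffineMap.lineMap y p s) ⁻¹' S)
      ⟨0, ⟨le_rfl, zero_le_one⟩, h0⟩
  rcases le_or_gt t s with hts | hst
  · exact hord.out h0 hsS ⟨ht.1, hts⟩
  exfalso
  set w := (AffineMap.lineMap y p s : Euc n) with hw
  have hout : ∀ q ∈ Ioc (0 : ℝ) 1, AffineMap.lineMap w p q ∉ S := by
    intro q hq hqS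
    have hs1 : s < 1 := hst.trans_le ht.2
    have hqw : (AffineMap.lineMap w p q : Euc n) = AffineMap.lineMap y p (s + q * (1 - s)) := by
      simp only [hw, AffineMap.lineMap_apply_module]
      module
    rw [hqw] at hqS
    have h1 : 0 < q * (1 - s) := mul_pos hq.1 (sub_pos.2 hs1)
    have := hmax ⟨⟨by linarith [hs.1], by nlinarith [hq.2]⟩, hqS⟩
    linarith
  obtain ⟨ν, hν, hν0⟩ := exists_isOuterNormalAt_inner_nonneg hconv hint hsS hout
  refine absurd (hvis w (hν.mem_frontier hsS) ν hν (lt_of_lt_of_le ?_ htc)) (not_lt.2 hν0)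
  rw [hw, inner_lineMap_sub, inner_lineMap_sub]
  have := mul_lt_mul_of_pos_right hst (sub_pos.2 hyp)
  linarith

/-- Corollary 2.8: for `S` of class `C²₊`, for every `ε > 0` there is `Δ₀ > 0` such that for
`0 ≤ Δ ≤ Δ₀` and `x ∈ ∂S`, `conv(S ∪ {x + Δu(x)}) = S₁ ∪ conv(S₂ ∪ {x + Δu(x)})`, where
`S₁ = S ∩ {ξ : ⟨ξ−x, u(x)⟩ ≤ −(1+ε)Δ}` and `S₂ = S ∩ {ξ : ⟨ξ−x, u(x)⟩ ≥ −(1+ε)Δ}`. -/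
theorem statement12 {n : ℕ} (hn : 2 ≤ n) (S : Set (Euc n))
    (u : Euc n → Euc n) (κ : Euc n → ℝ)
    (hS : IsSymConvexBody S) (hC2 : IsC2Body S u κ)
    (hκ : ∀ x ∈ frontier S, 0 < κ x) :
    ∀ ε > (0:ℝ), ∃ Δ₀ > (0:ℝ), ∀ Δ : ℝ, 0 ≤ Δ → Δ ≤ Δ₀ → ∀ x ∈ frontier S,
      convexHull ℝ (S ∪ {x + Δ • u x}) =
        (S ∩ {ξ | ⟪ξ - x, u x⟫ ≤ -((1+ε)*Δ)})
          ∪ convexHull ℝ ((S ∩ {ξ | -((1+ε)*Δ) ≤ ⟪ξ - x, u x⟫}) ∪ {x + Δ • u x}) := by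
  intro ε hε
  obtain ⟨hcpt, hconv, hint, -⟩ := hS
  obtain ⟨Δ₀, hΔ₀, hvis⟩ := hC2.exists_forall_inner_neg (by omega) hcpt hconv hκ hε
  refine ⟨Δ₀, hΔ₀, fun Δ hΔ hΔle x hx => ?_⟩
  have hcl := hcpt.isClosed
  set p := x + Δ • u x with hp
  have hpx : ⟪p - x, u x⟫ = Δ := by
    rw [hp, add_sub_cancel_left, inner_smul_left, real_inner_self_eq_norm_sq, (hC2 x hx).1.1]
    simp
  set c := -((1 + ε) * Δ) with hc
  have hεΔ : 0 ≤ (1 + ε) * Δ := by positivity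
  set S₂ := S ∩ {ξ | c ≤ ⟪ξ - x, u x⟫} with hS₂
  refine Subset.antisymm ?_ (union_subset (fun q hq => subset_convexHull ℝ _ (Or.inl hq.1))
    (convexHull_mono (union_subset_union_left _ inter_subset_left)))
  rw [union_singleton, convexHull_insert (hint.mono interior_subset), hconv.convexHull_eq]
  intro q hq
  obtain ⟨p', rfl, y, hy, hq⟩ := mem_convexJoin.1 hq
  have hpC : p ∈ convexHull ℝ (S₂ ∪ {p}) := subset_convexHull ℝ _ (Or.inr rfl)
  have hS₂C : S₂ ⊆ convexHull ℝ (S₂ ∪ {p}) := subset_union_left.trans (subset_convexHull ℝ _)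
  rcases le_or_gt c ⟪y - x, u x⟫ with hyc | hyc
  · exact Or.inr ((convex_convexHull ℝ _).segment_subset hpC (hS₂C ⟨hy, hyc⟩) hq)
  rw [segment_symm, segment_eq_image_lineMap] at hq
  obtain ⟨s, hs, rfl⟩ := hq
  have hyp : ⟪y - x, u x⟫ < ⟪p - x, u x⟫ := by
    rw [hpx]
    linarith
  have hmem : ∀ t ∈ Icc (0 : ℝ) 1, ⟪AffineMap.lineMap y p t - x, u x⟫ ≤ c →
      AffineMap.lineMap y p t ∈ S := fun t ht htc =>
    lineMap_mem_of_forall_inner_neg hcl hconv hint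
      (fun w hw ν hν => hvis Δ hΔ hΔle x hx w hw ν hν) hy hyp ht htc
  rcases le_or_gt ⟪AffineMap.lineMap y p s - x, u x⟫ c with hsc | hsc
  · exact Or.inl ⟨hmem s hs hsc, hsc⟩
  right
  set t := (c - ⟪y - x, u x⟫) / (⟪p - x, u x⟫ - ⟪y - x, u x⟫) with ht
  have hpos : 0 < ⟪p - x, u x⟫ - ⟪y - x, u x⟫ := sub_pos.2 hyp
  have htmul : t * (⟪p - x, u x⟫ - ⟪y - x, u x⟫) = c - ⟪y - x, u x⟫ :=
    div_mul_cancel₀ _ hpos.ne'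
  have htc : ⟪AffineMap.lineMap y p t - x, u x⟫ = c := by
    rw [inner_lineMap_sub, htmul]
    ring
  have hts : t ≤ s := by
    rw [inner_lineMap_sub] at hsc
    refine le_of_mul_le_mul_right ?_ hpos
    linarith
  have ht0 : 0 ≤ t := div_nonneg (by linarith) hpos.le
  have htC : AffineMap.lineMap y p t ∈ convexHull ℝ (S₂ ∪ {p}) :=
    hS₂C ⟨hmem t ⟨ht0, hts.trans hs.2⟩ htc.le, htc.ge⟩
  have hord : OrdConnected ((fun s : ℝ => AffineMap.lineMap y p s) ⁻¹' convexHull ℝ (S₂ ∪ {p})) :=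
    ((convex_convexHull ℝ _).affine_preimage (AffineMap.lineMap y p)).ordConnected
  exact hord.out htC (by simpa using hpC) ⟨hts, hs.2⟩
end
end

section
/- Let S ⊆ ℝⁿ (n ≥ 2) be a centrally symmetric convex body with C² boundary. Then there is a nonnegative function φ with φ(Δ) → 0 as Δ → 0 such that for every x ∈ ∂S and every sufficiently small Δ > 0, ((2Δ)^{(n+1)/2}/(n+1))·|B₂^{n−1}|_{n−1}/(κ(x) + φ(Δ))^{1/2} ≤ |{ξ ∈ S : ⟨ξ − x, u(x)⟩ ≥ −Δ}|ₙ. -/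
open MeasureTheory Metric Set Filter
open scoped RealInnerProductSpace Pointwise Topology

noncomputable section

/-- The Gram matrix of a bilinear form on `ℝᵐ` in the standard basis. -/
def gramMatrix {m : ℕ} (B : Euc m →L[ℝ] Euc m →L[ℝ] ℝ) : Matrix (Fin m) (Fin m) ℝ :=
  Matrix.of fun i j => B (EuclideanSpace.single i 1) (EuclideanSpace.single j 1)

lemma bilin_apply_eq_dotProduct {m : ℕ} (B : Euc m →L[ℝ] Euc m →L[ℝ] ℝ) (z w : Euc m) :
    B z w = z.ofLp ⬝ᵥ (gramMatrix B).mulVec w.ofLp := by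
  have hz : ∀ v : Euc m, v = ∑ i, v i • EuclideanSpace.single i (1 : ℝ) := by
    intro v
    conv_lhs => rw [← (EuclideanSpace.basisFun (Fin m) ℝ).sum_repr v]
    simp
  conv_lhs => rw [hz z, hz w]
  simp [gramMatrix, dotProduct, Matrix.mulVec, Finset.mul_sum]
  rw [Finset.sum_comm]
  refine Finset.sum_congr rfl fun i _ => Finset.sum_congr rfl fun j _ => by ring

open scoped MatrixOrder in
/-- A nonnegative symmetric bilinear form is `‖C z‖²` for some `C`, and its Gram determinant
is `(det C)²`. -/
lemma exists_factor {m : ℕ} (B : Euc m →L[ℝ] Euc m →L[ℝ] ℝ) (hsymm : ∀ z w, B z w = B w z)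
    (hpos : ∀ z, 0 ≤ B z z) :
    ∃ C : Euc m →ₗ[ℝ] Euc m, (∀ z, B z z = ‖C z‖ ^ 2) ∧
      (gramMatrix B).det = (LinearMap.det C) ^ 2 := by
  have hH : (gramMatrix B).PosSemidef := by
    refine .of_dotProduct_mulVec_nonneg ?_ fun x => ?_
    · ext i j
      simp [gramMatrix, hsymm]
    · have := hpos (WithLp.toLp 2 x)
      rw [bilin_apply_eq_dotProduct] at this
      simpa using this
  obtain ⟨D, hD⟩ := CStarAlgebra.nonneg_iff_eq_star_mul_self.mp hH.nonneg
  refine ⟨Matrix.toLpLin 2 2 D, fun z => ?_, ?_⟩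
  · rw [bilin_apply_eq_dotProduct, hD, ← Matrix.mulVec_mulVec, Matrix.dotProduct_mulVec,
      EuclideanSpace.real_norm_sq_eq]
    simp [Matrix.star_eq_conjTranspose, Matrix.vecMul_transpose, dotProduct, sq,
      Matrix.conjTranspose_eq_transpose_of_trivial]
  · rw [hD, Matrix.det_mul, LinearMap.det_toLpLin]
    simp [Matrix.star_eq_conjTranspose, sq]

lemma volume_setOf_norm_le {m : ℕ} {T : Euc m →ₗ[ℝ] Euc m} (hT : LinearMap.det T ≠ 0) {R : ℝ}
    (hR : 0 ≤ R) :
    volume {z | ‖T z‖ ≤ R} =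
      ENNReal.ofReal (R ^ m / |LinearMap.det T|) * volume (ball (0 : Euc m) 1) := by
  have h : {z | ‖T z‖ ≤ R} = T ⁻¹' closedBall 0 R := by ext; simp
  rw [h, Measure.addHaar_preimage_linearMap _ hT, Measure.addHaar_closedBall _ _ hR, ← mul_assoc,
    ← ENNReal.ofReal_mul (by positivity)]
  simp [abs_inv, div_eq_inv_mul]

/-- Pointwise domination of linear endomorphisms gives domination of determinants. -/
lemma abs_det_le_abs_det {m : ℕ} {T₁ T₂ : Euc m →ₗ[ℝ] Euc m} (h : ∀ z, ‖T₁ z‖ ≤ ‖T₂ z‖) :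
    |LinearMap.det T₁| ≤ |LinearMap.det T₂| := by
  by_cases h1 : LinearMap.det T₁ = 0
  · simp [h1]
  have h2 : LinearMap.det T₂ ≠ 0 := by
    have hinj : Function.Injective T₂ := by
      rw [injective_iff_map_eq_zero]
      intro z hz
      have h3 : T₁ z = 0 := norm_le_zero_iff.1 (by simpa [hz] using h z)
      exact (injective_iff_map_eq_zero _).1 (T₁.equivOfDetNeZero h1).injective z h3
    have := (LinearMap.isUnit_iff_ker_eq_bot T₂).2 (LinearMap.ker_eq_bot.2 hinj)
    exact (this.map LinearMap.det).ne_zero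
  have hsub : {z | ‖T₂ z‖ ≤ 1} ⊆ {z | ‖T₁ z‖ ≤ 1} := fun z hz => (h z).trans hz
  have hv := measure_mono (μ := volume) hsub
  rw [volume_setOf_norm_le h1 zero_le_one, volume_setOf_norm_le h2 zero_le_one,
    ENNReal.mul_le_mul_iff_left (measure_ball_pos _ _ one_pos).ne' measure_ball_lt_top.ne,
    ENNReal.ofReal_le_ofReal_iff (by positivity)] at hv
  simp only [one_pow, one_div] at hv
  exact (inv_le_inv₀ (abs_pos.2 h2) (abs_pos.2 h1)).1 hv

/-- The volume of the paraboloid cap `{‖T z‖² / 2 ≤ r ≤ Δ}`. -/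
lemma volume_paraboloid {m : ℕ} {T : Euc m →ₗ[ℝ] Euc m} (hT : LinearMap.det T ≠ 0) {Δ : ℝ}
    (hΔ : 0 ≤ Δ) :
    volume {p : Euc m × ℝ | ‖T p.1‖ ^ 2 / 2 ≤ p.2 ∧ p.2 ≤ Δ} =
      ENNReal.ofReal ((2 * Δ) ^ ((m : ℝ) / 2 + 1) / (m + 2) / |LinearMap.det T|) *
        volume (ball (0 : Euc m) 1) := by
  have hTc : Continuous T := T.continuous_of_finiteDimensional
  have hm : MeasurableSet {p : Euc m × ℝ | ‖T p.1‖ ^ 2 / 2 ≤ p.2 ∧ p.2 ≤ Δ} :=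
    (measurableSet_le (f := fun p : Euc m × ℝ => ‖T p.1‖ ^ 2 / 2) (g := fun p => p.2)
      (by fun_prop) (by fun_prop)).inter
      (measurableSet_le (f := fun p : Euc m × ℝ => p.2) (g := fun _ => Δ)
        (by fun_prop) (by fun_prop))
  rw [Measure.volume_eq_prod, Measure.prod_apply_symm hm]
  have hslice : ∀ r : ℝ,
      volume ((fun z : Euc m => (z, r)) ⁻¹' {p : Euc m × ℝ | ‖T p.1‖ ^ 2 / 2 ≤ p.2 ∧ p.2 ≤ Δ}) =
      (Icc 0 Δ).indicator (fun r => ENNReal.ofReal ((2 * r) ^ ((m : ℝ) / 2) / |LinearMap.det T|) *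
        volume (ball (0 : Euc m) 1)) r := by
    intro r
    by_cases hr : r ∈ Icc 0 Δ
    · rw [indicator_of_mem hr]
      have : (fun z : Euc m => (z, r)) ⁻¹' {p : Euc m × ℝ | ‖T p.1‖ ^ 2 / 2 ≤ p.2 ∧ p.2 ≤ Δ} =
          {z | ‖T z‖ ≤ √(2 * r)} := by
        ext z
        simp only [mem_preimage, mem_ofPred_eq, hr.2, and_true]
        rw [Real.le_sqrt (norm_nonneg _) (by linarith [hr.1])]
        constructor <;> intro h <;> linarith
      rw [this, volume_setOf_norm_le hT (Real.sqrt_nonneg _), Real.sqrt_eq_rpow,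
        ← Real.rpow_natCast, ← Real.rpow_mul (by linarith [hr.1])]
      ring_nf
    · rw [indicator_of_notMem hr]
      refine (congrArg _ (eq_empty_of_forall_notMem fun z hz => ?_)).trans measure_empty
      exact hr ⟨le_trans (by positivity) hz.1, hz.2⟩
  simp_rw [hslice]
  rw [lintegral_indicator measurableSet_Icc, lintegral_mul_const' _ _ measure_ball_lt_top.ne]
  congr 1
  have hcont : Continuous fun r : ℝ => (2 * r) ^ ((m : ℝ) / 2) / |LinearMap.det T| := by
    refine Continuous.div_const ?_ _
    exact (continuous_const.mul continuous_id).rpow_const fun _ => Or.inr (by positivity)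
  rw [← ofReal_integral_eq_lintegral_ofReal (hcont.integrableOn_Icc)
    ((ae_restrict_iff' measurableSet_Icc).2 (ae_of_all _ fun r hr => by
      have := hr.1
      simp only [Pi.zero_apply]; positivity)),
    integral_Icc_eq_integral_Ioc, ← intervalIntegral.integral_of_le hΔ,
    intervalIntegral.integral_div]
  congr 2
  rw [intervalIntegral.integral_comp_mul_left (fun r => r ^ ((m : ℝ) / 2)) two_ne_zero,
    integral_rpow (Or.inl (lt_of_lt_of_le (by norm_num) (show (0 : ℝ) ≤ m / 2 by positivity)))]
  rw [mul_zero, Real.zero_rpow (by positivity), smul_eq_mul]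
  field_simp
  ring

section Frame

variable {m : ℕ} {L : Euc m →ₗᵢ[ℝ] Euc (m + 1)} {ν : Euc (m + 1)}

lemma norm_sq_frame (hν : ‖ν‖ = 1) (hL : ∀ v, ⟪L v, ν⟫ = 0) (z : Euc m) (s : ℝ) :
    ‖L z - s • ν‖ ^ 2 = ‖z‖ ^ 2 + s ^ 2 := by
  rw [norm_sub_sq_real, inner_smul_right, hL, norm_smul, hν, L.norm_map]
  simp

/-- The isometry `(z, s) ↦ L z - s ν`. -/
lemma exists_frame_isometry (hν : ‖ν‖ = 1) (hL : ∀ v, ⟪L v, ν⟫ = 0) :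
    ∃ J : WithLp 2 (Euc m × ℝ) ≃ₗᵢ[ℝ] Euc (m + 1), ∀ p, J p = L p.fst - p.snd • ν := by
  let J₀ : WithLp 2 (Euc m × ℝ) →ₗ[ℝ] Euc (m + 1) :=
    { toFun := fun p => L p.fst - p.snd • ν
      map_add' := fun p q => by simp [add_smul]; abel
      map_smul' := fun a p => by simp [smul_sub, mul_smul] }
  let J₁ : WithLp 2 (Euc m × ℝ) →ₗᵢ[ℝ] Euc (m + 1) :=
    { J₀ with
      norm_map' := fun p => by
        have h := norm_sq_frame hν hL p.fst p.snd
        have h2 := WithLp.prod_norm_sq_eq_of_L2 p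
        rw [Real.norm_eq_abs, sq_abs, ← h] at h2
        exact ((sq_eq_sq₀ (norm_nonneg _) (norm_nonneg _)).1 h2).symm }
  have hdim : Module.finrank ℝ (WithLp 2 (Euc m × ℝ)) = Module.finrank ℝ (Euc (m + 1)) := by
    rw [(WithLp.linearEquiv 2 ℝ (Euc m × ℝ)).finrank_eq]
    simp
  exact ⟨J₁.toLinearIsometryEquiv hdim, fun p => rfl⟩

lemma exists_frame_decomp (hν : ‖ν‖ = 1) (hL : ∀ v, ⟪L v, ν⟫ = 0) (ξ : Euc (m + 1)) :
    ∃ z : Euc m, ξ = L z + ⟪ξ, ν⟫ • ν := by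
  obtain ⟨J, hJ⟩ := exists_frame_isometry hν hL
  obtain ⟨p, rfl⟩ := J.surjective ξ
  refine ⟨p.fst, ?_⟩
  rw [hJ, inner_sub_left, hL, inner_smul_left, real_inner_self_eq_norm_sq, hν]
  simp [sub_eq_add_neg]

lemma measurePreserving_graph (hν : ‖ν‖ = 1) (hL : ∀ v, ⟪L v, ν⟫ = 0) (x : Euc (m + 1))
    (T : Euc m →L[ℝ] ℝ) :
    MeasurePreserving (fun p : Euc m × ℝ => x + (L p.1 - (T p.1 + p.2) • ν)) volume volume := by
  obtain ⟨J, hJ⟩ := exists_frame_isometry hν hL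
  have h1 : MeasurePreserving (fun p : Euc m × ℝ => (p.1, T p.1 + p.2)) volume volume := by
    rw [Measure.volume_eq_prod]
    exact (MeasurePreserving.id _).skew_product (g := fun z r => T z + r) (by fun_prop)
      (ae_of_all _ fun z => map_add_left_eq_self volume (T z))
  have h2 := (measurePreserving_add_left volume x).comp
    ((J.measurePreserving.comp (WithLp.volume_preserving_toLp _ _)).comp h1)
  convert! h2 using 1
  ext1 p
  simp [hJ]

end Frame

/-- Second-order Taylor expansion around all points near `0`, with the Hessian frozen at `0`. -/
lemma taylor_uniform {m : ℕ} {f : Euc m → ℝ} (hf : ContDiffAt ℝ 2 f 0) {η : ℝ} (hη : 0 < η) :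
    ∃ ρ > 0, ∀ v ∈ ball (0 : Euc m) ρ, ∀ w ∈ ball (0 : Euc m) ρ,
      DifferentiableAt ℝ f v ∧
      |f w - f v - fderiv ℝ f v (w - v) -
        fderiv ℝ (fderiv ℝ f) 0 (w - v) (w - v) / 2| ≤ η * ‖w - v‖ ^ 2 := by
  set B := fderiv ℝ (fderiv ℝ f) 0 with hB
  have hsymm : ∀ a b, B a b = B b a := (hf.isSymmSndFDerivAt (by simp)).eq
  have hstrict : HasStrictFDerivAt (fderiv ℝ f) B 0 :=
    (hf.fderiv_right (m := 1) (by norm_num)).hasStrictFDerivAt (by norm_num)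
  have h1 := (hasStrictFDerivAt_iff_isLittleO.1 hstrict).def hη
  have hd : ∀ᶠ v in 𝓝 (0 : Euc m), DifferentiableAt ℝ f v :=
    (hf.eventually (by simp)).mono fun v hv => hv.differentiableAt (by norm_num)
  rw [nhds_prod_eq] at h1
  obtain ⟨ρ, hρ, h2⟩ := Metric.eventually_nhds_iff_ball.1 hd
  obtain ⟨s, hs, h3⟩ := eventually_prod_self_iff'.1 h1
  obtain ⟨ρ', hρ', h4⟩ := Metric.mem_nhds_iff.1 hs
  refine ⟨min ρ ρ', lt_min hρ hρ', fun v hv w hw => ?_⟩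
  have hdv : ∀ y ∈ ball (0 : Euc m) (min ρ ρ'), DifferentiableAt ℝ f y :=
    fun y hy => (h2 y (ball_subset_ball (min_le_left _ _) hy))
  refine ⟨hdv v hv, ?_⟩
  have hseg : segment ℝ v w ⊆ ball (0 : Euc m) (min ρ ρ') := (convex_ball _ _).segment_subset hv hw
  let g : Euc m → ℝ := fun y => f y - B (y - v) (y - v) / 2
  have hg : ∀ y ∈ segment ℝ v w,
      HasFDerivWithinAt g (fderiv ℝ f y - B (y - v)) (segment ℝ v w) y := by
    intro y hy
    have hBy : HasFDerivAt (fun y => B (y - v) (y - v) / 2) (B (y - v)) y := by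
      have hid : HasFDerivAt (fun y : Euc m => y - v) (ContinuousLinearMap.id ℝ (Euc m)) y :=
        (hasFDerivAt_id y).sub_const v
      have h5 := ((B.hasFDerivAt.comp y hid).clm_apply hid).const_mul (1 / 2 : ℝ)
      convert! h5 using 1
      · ext1 y; simp; ring
      · ext t
        simp [hsymm t y, hsymm t v]
        ring
    exact ((hdv y (hseg hy)).hasFDerivAt.sub hBy).hasFDerivWithinAt
  have hbound : ∀ y ∈ segment ℝ v w,
      ‖(fderiv ℝ f y - B (y - v)) - fderiv ℝ f v‖ ≤ η * ‖w - v‖ := by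
    intro y hy
    have h6 := h3 y (h4 (ball_subset_ball (min_le_right _ _) (hseg hy))) v
      (h4 (ball_subset_ball (min_le_right _ _) hv))
    simp only at h6
    rw [sub_right_comm]
    refine h6.trans (mul_le_mul_of_nonneg_left ?_ hη.le)
    obtain ⟨t, ht, rfl⟩ := segment_eq_image' ℝ v w ▸ hy
    rw [add_sub_cancel_left, norm_smul, Real.norm_of_nonneg ht.1]
    exact mul_le_of_le_one_left (norm_nonneg _) ht.2
  have h7 := (convex_segment v w).norm_image_sub_le_of_norm_hasFDerivWithin_le' hg hbound
    (left_mem_segment ℝ v w) (right_mem_segment ℝ v w)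
  rw [Real.norm_eq_abs] at h7
  simp only [g, sub_self, map_zero, zero_div, sub_zero] at h7
  calc _ = _ := by congr 1; ring
    _ ≤ _ := h7
    _ = _ := by ring

/-- Near `x₀`, the frontier of `S` is the graph of `f` over the hyperplane `x₀ + range L`
orthogonal to the outer unit normal `ν`, with `f` vanishing to first order at `0`. -/
structure IsGraphChart {m : ℕ} (S : Set (Euc (m + 1))) (x₀ ν : Euc (m + 1))
    (L : Euc m →ₗᵢ[ℝ] Euc (m + 1)) (f : Euc m → ℝ) : Prop where
  norm_normal : ‖ν‖ = 1
  inner_le : ∀ y ∈ S, ⟪y, ν⟫ ≤ ⟪x₀, ν⟫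
  orth : ∀ v, ⟪L v, ν⟫ = 0
  contDiffAt : ContDiffAt ℝ 2 f 0
  map_zero : f 0 = 0
  fderiv_zero : fderiv ℝ f 0 = 0
  eventually_mem : ∀ᶠ v in 𝓝 0, x₀ + L v - f v • ν ∈ frontier S
  eventually_eq : ∀ s ∈ 𝓝 (0 : Euc m), ∀ᶠ x in 𝓝 x₀, x ∈ frontier S →
    ∃ v ∈ s, x = x₀ + L v - f v • ν

lemma adjoint_apply_frame {m : ℕ} {L : Euc m →ₗᵢ[ℝ] Euc (m + 1)} {ν : Euc (m + 1)}
    (hL : ∀ v, ⟪L v, ν⟫ = 0) (z : Euc m) (s : ℝ) :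
    ContinuousLinearMap.adjoint L.toContinuousLinearMap (L z - s • ν) = z := by
  refine ext_inner_left ℝ fun w => ?_
  rw [ContinuousLinearMap.adjoint_inner_right, LinearIsometry.coe_toContinuousLinearMap,
    inner_sub_right, L.inner_map_map, inner_smul_right, hL]
  simp

lemma norm_sq_eq_adjoint {m : ℕ} {L : Euc m →ₗᵢ[ℝ] Euc (m + 1)} {ν : Euc (m + 1)}
    (hν : ‖ν‖ = 1) (hL : ∀ v, ⟪L v, ν⟫ = 0) (ξ : Euc (m + 1)) :
    ‖ξ‖ ^ 2 = ‖ContinuousLinearMap.adjoint L.toContinuousLinearMap ξ‖ ^ 2 + ⟪ξ, ν⟫ ^ 2 := by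
  obtain ⟨z, hz⟩ := exists_frame_decomp hν hL ξ
  have h1 : ξ = L z - (-⟪ξ, ν⟫) • ν := by rw [neg_smul, sub_neg_eq_add]; exact hz
  have h2 : ContinuousLinearMap.adjoint L.toContinuousLinearMap ξ = z := by
    rw [h1]; exact adjoint_apply_frame hL z _
  rw [h2]
  conv_lhs => rw [h1]
  rw [norm_sq_frame hν hL, neg_sq]

lemma exists_graphChart {m : ℕ} {S : Set (Euc (m + 1))} {x ν : Euc (m + 1)} {k : ℝ}
    (hν : IsOuterNormalAt S x ν) (hk : IsGaussCurvatureAt S x ν k) :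
    ∃ (L : Euc m →ₗᵢ[ℝ] Euc (m + 1)) (f : Euc m → ℝ), IsGraphChart S x ν L f ∧
      k = (gramMatrix (fderiv ℝ (fderiv ℝ f) 0)).det := by
  obtain ⟨L, f, τ, ε, hτ, hε, hL, hf, hf0, hdf0, hgraph, hk⟩ := hk
  change Euc m →ₗᵢ[ℝ] Euc (m + 1) at L
  change Euc m → ℝ at f
  have hfd : ContDiffAt ℝ 2 f 0 := hf.contDiffAt (ball_mem_nhds 0 hτ)
  refine ⟨L, f, ⟨hν.1, hν.2, hL, hfd, hf0, hdf0, ?_, ?_⟩, ?_⟩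
  · have hcont : ContinuousAt (fun v => x + L v - f v • ν) 0 :=
      (continuousAt_const.add L.continuous.continuousAt).sub
        (hfd.continuousAt.smul continuousAt_const)
    have hx : (fun v => x + L v - f v • ν) 0 = x := by simp [hf0]
    have h1 : ∀ᶠ v in 𝓝 (0 : Euc m), x + L v - f v • ν ∈ ball x ε :=
      hcont (by rw [hx]; exact ball_mem_nhds x hε)
    filter_upwards [h1, ball_mem_nhds (0 : Euc m) hτ] with v hv1 hv2
    have : x + L v - f v • ν ∈ frontier S ∩ ball x ε := by
      rw [hgraph]
      exact ⟨⟨v, hv2, rfl⟩, hv1⟩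
    exact this.1
  · intro s hs
    obtain ⟨δ, hδ, hδs⟩ := Metric.mem_nhds_iff.1 hs
    filter_upwards [ball_mem_nhds x hε, ball_mem_nhds x hδ] with y hy1 hy2 hy
    have : y ∈ frontier S ∩ ball x ε := ⟨hy, hy1⟩
    rw [hgraph] at this
    obtain ⟨⟨v, -, hv⟩, -⟩ := this
    change Euc m at v
    change y = x + L v - f v • ν at hv
    refine ⟨v, hδs ?_, hv⟩
    rw [mem_ball_zero_iff]
    have h2 : ‖L v - f v • ν‖ < δ := by
      have h3 := mem_ball_iff_norm.1 hy2
      rwa [hv, add_sub_assoc, add_sub_cancel_left] at h3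
    have h4 := norm_sq_frame hν.1 hL v (f v)
    refine lt_of_le_of_lt ?_ h2
    exact abs_le_of_sq_le_sq' (by nlinarith [sq_nonneg (f v)]) (norm_nonneg _) |>.2
  · rw [hk]
    congr 1
    ext i j
    change iteratedFDeriv ℝ 2 f 0 _ = _
    rw [iteratedFDeriv_two_apply]
    rfl

namespace IsGraphChart

variable {m : ℕ} {S : Set (Euc (m + 1))} {x₀ ν : Euc (m + 1)}
  {L : Euc m →ₗᵢ[ℝ] Euc (m + 1)} {f : Euc m → ℝ}

lemma tendsto_div_sq (hc : IsGraphChart S x₀ ν L f) (z : Euc m) :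
    Tendsto (fun t : ℝ => f (t • z) / t ^ 2) (𝓝[>] 0)
      (𝓝 (fderiv ℝ (fderiv ℝ f) 0 z z / 2)) := by
  rw [Metric.tendsto_nhds]
  intro ε hε
  have hη : 0 < ε / (2 * (‖z‖ ^ 2 + 1)) := by positivity
  obtain ⟨ρ, hρ, h⟩ := taylor_uniform hc.contDiffAt hη
  have ht : ∀ᶠ t : ℝ in 𝓝 0, t • z ∈ ball (0 : Euc m) ρ := by
    have hcz : ContinuousAt (fun t : ℝ => t • z) 0 := by fun_prop
    exact hcz (by simpa using ball_mem_nhds (0 : Euc m) hρ)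
  filter_upwards [nhdsWithin_le_nhds ht, self_mem_nhdsWithin] with t ht1 ht2
  have h1 := (h 0 (mem_ball_self hρ) (t • z) ht1).2
  have ht0 : (0 : ℝ) < t := ht2
  rw [hc.map_zero, hc.fderiv_zero] at h1
  simp only [sub_zero, zero_apply, map_smul, smul_apply, mul_zero,
    smul_eq_mul, norm_smul] at h1
  rw [Real.dist_eq]
  have h2 : f (t • z) / t ^ 2 - fderiv ℝ (fderiv ℝ f) 0 z z / 2 =
      (f (t • z) - t * (t * fderiv ℝ (fderiv ℝ f) 0 z z) / 2) / t ^ 2 := by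
    field_simp
  rw [h2, abs_div, abs_of_pos (by positivity : 0 < t ^ 2), div_lt_iff₀ (by positivity)]
  refine h1.trans_lt ?_
  rw [mul_pow, Real.norm_eq_abs, sq_abs, div_mul_eq_mul_div, div_lt_iff₀ (by positivity)]
  have : 0 < ε * t ^ 2 := by positivity
  nlinarith [sq_nonneg ‖z‖]

lemma eventually_nonneg (hc : IsGraphChart S x₀ ν L f) (hS : IsClosed S) :
    ∀ᶠ v in 𝓝 0, 0 ≤ f v := by
  filter_upwards [hc.eventually_mem] with v hv
  have h := hc.inner_le _ (hS.frontier_subset hv)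
  rw [inner_sub_left, inner_add_left, hc.orth, inner_smul_left, real_inner_self_eq_norm_sq,
    hc.norm_normal] at h
  simp at h
  linarith

lemma hessian_nonneg (hc : IsGraphChart S x₀ ν L f) (hS : IsClosed S) (z : Euc m) :
    0 ≤ fderiv ℝ (fderiv ℝ f) 0 z z := by
  have hcz : Tendsto (fun t : ℝ => t • z) (𝓝 0) (𝓝 0) := by
    have : ContinuousAt (fun t : ℝ => t • z) 0 := by fun_prop
    simpa [ContinuousAt] using this
  have h := ge_of_tendsto (b := 0) (hc.tendsto_div_sq z) (by
    filter_upwards [nhdsWithin_le_nhds (hcz.eventually (hc.eventually_nonneg hS))] with t ht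
    positivity)
  linarith

lemma hessian_symm (hc : IsGraphChart S x₀ ν L f) (z w : Euc m) :
    fderiv ℝ (fderiv ℝ f) 0 z w = fderiv ℝ (fderiv ℝ f) 0 w z :=
  (hc.contDiffAt.isSymmSndFDerivAt (by simp)).eq z w

end IsGraphChart

/-- A supporting functional at a point of a graph is a multiple of the graph's conormal. -/
lemma inner_eq_of_graph {m : ℕ} {S : Set (Euc (m + 1))} {x₀ ν : Euc (m + 1)}
    {L : Euc m →ₗᵢ[ℝ] Euc (m + 1)} {f : Euc m → ℝ} {v : Euc m} {u : Euc (m + 1)}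
    (hmem : ∀ᶠ w in 𝓝 v, x₀ + L w - f w • ν ∈ S) (hf : DifferentiableAt ℝ f v)
    (hu : ∀ y ∈ S, ⟪y, u⟫ ≤ ⟪x₀ + L v - f v • ν, u⟫) (z : Euc m) :
    ⟪L z, u⟫ = ⟪ν, u⟫ * fderiv ℝ f v z := by
  have hmax : IsLocalMax (fun w => ⟪u, x₀ + L w - f w • ν⟫) v := by
    filter_upwards [hmem] with w hw
    rw [real_inner_comm, real_inner_comm _ u]
    exact hu _ hw
  have hd : HasFDerivAt (fun w => ⟪u, x₀ + L w - f w • ν⟫)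
      ((innerSL ℝ u) ∘L (L.toContinuousLinearMap - (fderiv ℝ f v).smulRight ν)) v := by
    have h1 : HasFDerivAt (fun w => x₀ + L w - f w • ν)
        (L.toContinuousLinearMap - (fderiv ℝ f v).smulRight ν) v :=
      (L.toContinuousLinearMap.hasFDerivAt.const_add x₀).sub (hf.hasFDerivAt.smul_const ν)
    exact (innerSL ℝ u).hasFDerivAt.comp v h1
  have h := DFunLike.congr_fun (hmax.hasFDerivAt_eq_zero hd) z
  simp at h
  rw [real_inner_comm, real_inner_comm u ν]
  linarith

namespace IsGraphChart

variable {m : ℕ} {S : Set (Euc (m + 1))} {x₀ ν : Euc (m + 1)}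
  {L : Euc m →ₗᵢ[ℝ] Euc (m + 1)} {f : Euc m → ℝ}

lemma mem_frontier (hc : IsGraphChart S x₀ ν L f) : x₀ ∈ frontier S := by
  simpa [hc.map_zero] using hc.eventually_mem.self_of_nhds

lemma tendsto_graph (hc : IsGraphChart S x₀ ν L f) :
    Tendsto (fun v => x₀ + L v - f v • ν) (𝓝 0) (𝓝 x₀) := by
  have hcont : ContinuousAt (fun v => x₀ + L v - f v • ν) 0 :=
    (continuousAt_const.add L.continuous.continuousAt).sub
      (hc.contDiffAt.continuousAt.smul continuousAt_const)
  simpa [ContinuousAt, hc.map_zero] using hcont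

lemma tendsto_fderiv (hc : IsGraphChart S x₀ ν L f) : Tendsto (fderiv ℝ f) (𝓝 0) (𝓝 0) := by
  have h := (hc.contDiffAt.fderiv_right (m := 1) (by norm_num)).continuousAt
  rwa [ContinuousAt, hc.fderiv_zero] at h

lemma exists_mem_interior (hc : IsGraphChart S x₀ ν L f) (hS : IsClosed S) (hconv : Convex ℝ S)
    (hint : (interior S).Nonempty) : ∃ s : ℝ, 0 < s ∧ x₀ - s • ν ∈ interior S := by
  by_contra! hno
  have hx₀ := hc.mem_frontier
  have hdisj : Disjoint (interior S) ((fun s : ℝ => x₀ - s • ν) '' Ici 0) := by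
    rw [Set.disjoint_right]
    rintro _ ⟨s, hs, rfl⟩ h
    rcases (mem_Ici.1 hs).eq_or_lt with rfl | hs
    · exact hx₀.2 (by simpa using h)
    · exact hno s hs h
  have hray : Convex ℝ ((fun s : ℝ => x₀ - s • ν) '' Ici 0) := by
    rintro _ ⟨s, hs, rfl⟩ _ ⟨t, ht, rfl⟩ a b ha hb hab
    refine ⟨a * s + b * t, add_nonneg (mul_nonneg ha hs) (mul_nonneg hb ht), ?_⟩
    have : x₀ = (a + b) • x₀ := by rw [hab, one_smul]
    simp only
    conv_lhs => rw [this]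
    module
  obtain ⟨g, α, hg1, hg2⟩ := geometric_hahn_banach_open hconv.interior isOpen_interior hray hdisj
  obtain ⟨ℓ, rfl⟩ := (InnerProductSpace.toDual ℝ _).surjective g
  simp only [InnerProductSpace.toDual_apply_apply] at hg1 hg2
  have hS_le : ∀ y ∈ S, ⟪ℓ, y⟫ ≤ α := by
    intro y hy
    have hcl : y ∈ closure (interior S) := by
      rw [hconv.closure_interior_eq_closure_of_nonempty_interior hint]
      exact subset_closure hy
    have hcld : IsClosed {y : Euc (m + 1) | ⟪ℓ, y⟫ ≤ α} := isClosed_le (by fun_prop) (by fun_prop)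
    exact closure_minimal (fun y hy => (hg1 y hy).le) hcld hcl
  have h0 : α ≤ ⟪ℓ, x₀⟫ := hg2 x₀ ⟨0, by simp, by simp⟩
  have h1 : α ≤ ⟪ℓ, x₀ - (1 : ℝ) • ν⟫ := hg2 _ ⟨1, by simp, rfl⟩
  have hx₀α := hS_le x₀ (hS.frontier_subset hx₀)
  have hperp : ∀ z, ⟪L z, ℓ⟫ = 0 := by
    intro z
    have := inner_eq_of_graph (v := 0) (u := ℓ)
      (hc.eventually_mem.mono fun w hw => hS.frontier_subset hw)
      (hc.contDiffAt.differentiableAt (by norm_num)) (fun y hy => by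
        rw [real_inner_comm, real_inner_comm ℓ]
        simpa [hc.map_zero] using (hS_le y hy).trans h0) z
    simpa [hc.fderiv_zero] using this
  obtain ⟨p, hp⟩ := hint
  have hp1 := hg1 p hp
  have hp2 := hc.inner_le p (interior_subset hp)
  obtain ⟨z, hz⟩ := exists_frame_decomp hc.norm_normal hc.orth (p - x₀)
  have h2 : ⟪p - x₀, ℓ⟫ = ⟪p - x₀, ν⟫ * ⟪ν, ℓ⟫ := by
    conv_lhs => rw [hz]
    rw [inner_add_left, hperp, inner_smul_left]
    simp
  rw [inner_sub_left, inner_sub_left, real_inner_comm, real_inner_comm ℓ x₀] at h2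
  rw [one_smul, inner_sub_right, real_inner_comm ν ℓ] at h1
  nlinarith

/-- Locally `S` contains everything between its boundary graph and a fixed depth. -/
lemma exists_depth (hc : IsGraphChart S x₀ ν L f) (hS : IsClosed S) (hconv : Convex ℝ S)
    (hint : (interior S).Nonempty) : ∃ s₁ : ℝ, 0 < s₁ ∧ (∀ᶠ x in 𝓝 x₀, x - s₁ • ν ∈ S) ∧
      ∀ᶠ v in 𝓝 (0 : Euc m), ∀ s, f v ≤ s → s ≤ s₁ → x₀ + L v - s • ν ∈ S := by
  obtain ⟨s₁, hs₁, h⟩ := hc.exists_mem_interior hS hconv hint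
  have h1 : ∀ᶠ x in 𝓝 x₀, x - s₁ • ν ∈ S := by
    have hcx : ContinuousAt (fun x => x - s₁ • ν) x₀ := by fun_prop
    exact hcx (mem_interior_iff_mem_nhds.1 h)
  refine ⟨s₁, hs₁, h1, ?_⟩
  have hLt : Tendsto (fun v => x₀ + L v) (𝓝 0) (𝓝 x₀) := by
    have : ContinuousAt (fun v => x₀ + L v) 0 :=
      continuousAt_const.add L.continuous.continuousAt
    simpa [ContinuousAt] using this
  filter_upwards [hc.eventually_mem, hLt.eventually h1] with v hv1 hv2 s hs hs'
  have hseg := hconv.segment_subset (hS.frontier_subset hv1) hv2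
  rcases hs.eq_or_lt with rfl | hlt
  · exact hS.frontier_subset hv1
  refine hseg ?_
  have hpos : 0 < s₁ - f v := by linarith
  rw [segment_eq_image']
  refine ⟨(s - f v) / (s₁ - f v), ⟨div_nonneg (by linarith) hpos.le,
    (div_le_one hpos).2 (by linarith)⟩, ?_⟩
  have h3 : s = f v + (s - f v) / (s₁ - f v) * (s₁ - f v) := by field_simp; ring
  conv_rhs => rw [h3]
  simp only
  module

/-- Outer unit normals at graph points near the base point. -/
lemma eventually_normal (hc : IsGraphChart S x₀ ν L f) (hS : IsClosed S) (hconv : Convex ℝ S)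
    (hint : (interior S).Nonempty) : ∀ᶠ v in 𝓝 (0 : Euc m), ∀ u,
      IsOuterNormalAt S (x₀ + L v - f v • ν) u →
      0 ≤ ⟪ν, u⟫ ∧ ⟪ν, u⟫ ≤ 1 ∧ 1 - ‖fderiv ℝ f v‖ ≤ ⟪ν, u⟫ ^ 2 ∧
        ∀ z, ⟪L z, u⟫ = ⟪ν, u⟫ * fderiv ℝ f v z := by
  obtain ⟨s₁, hs₁, h1, -⟩ := hc.exists_depth hS hconv hint
  have hd : ∀ᶠ v in 𝓝 (0 : Euc m), DifferentiableAt ℝ f v :=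
    (hc.contDiffAt.eventually (by simp)).mono fun v hv => hv.differentiableAt (by norm_num)
  filter_upwards [hc.tendsto_graph.eventually h1, hc.eventually_mem.eventually_nhds, hd]
    with v hv1 hv2 hv3 u hu
  have hgrad := inner_eq_of_graph (hv2.mono fun w hw => hS.frontier_subset hw) hv3 hu.2
  have hle1 : |⟪ν, u⟫| ≤ 1 := by
    simpa [hc.norm_normal, hu.1] using abs_real_inner_le_norm ν u
  refine ⟨?_, (abs_le.1 hle1).2, ?_, hgrad⟩
  · have := hu.2 _ hv1
    rw [inner_sub_left _ (s₁ • ν), inner_smul_left] at this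
    simp only [conj_trivial] at this
    have h2 : 0 ≤ s₁ * ⟪ν, u⟫ := by linarith
    exact nonneg_of_mul_nonneg_right h2 hs₁
  · have h3 := norm_sq_eq_adjoint hc.norm_normal hc.orth u
    set a := ContinuousLinearMap.adjoint L.toContinuousLinearMap u with ha
    rw [hu.1, real_inner_comm] at h3
    have h4 : ‖a‖ ^ 2 = ⟪ν, u⟫ * fderiv ℝ f v a := by
      rw [← hgrad a, ← real_inner_self_eq_norm_sq]
      conv_lhs => rw [ha, ContinuousLinearMap.adjoint_inner_right]
      rfl
    have ha1 : ‖a‖ ≤ 1 := by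
      have := sq_nonneg ⟪ν, u⟫
      exact abs_le_of_sq_le_sq' (by nlinarith) zero_le_one |>.2
    have h5 : ⟪ν, u⟫ * fderiv ℝ f v a ≤ ‖fderiv ℝ f v‖ := by
      calc _ ≤ |⟪ν, u⟫ * fderiv ℝ f v a| := le_abs_self _
        _ = |⟪ν, u⟫| * ‖fderiv ℝ f v a‖ := by rw [abs_mul, Real.norm_eq_abs]
        _ ≤ 1 * (‖fderiv ℝ f v‖ * 1) := by
          gcongr
          exact ((fderiv ℝ f v).le_opNorm a).trans (by gcongr)
        _ = _ := by ring
    linarith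

/-- A cap near the base point contains the image of a paraboloid with the Hessian frozen at the
base point. -/
lemma paraboloid_subset_cap (hc : IsGraphChart S x₀ ν L f) (hS : IsClosed S) (hconv : Convex ℝ S)
    (hint : (interior S).Nonempty) {η : ℝ} (hη : 0 < η) :
    ∃ δ > 0, ∀ᶠ v in 𝓝 (0 : Euc m), ∀ u, IsOuterNormalAt S (x₀ + L v - f v • ν) u →
      ∀ Δ ≤ δ, ∀ (z : Euc m) (r : ℝ),
        fderiv ℝ (fderiv ℝ f) 0 z z / 2 + η * ‖z‖ ^ 2 ≤ r → r ≤ Δ →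
        (x₀ + L v - f v • ν) + (L z - (fderiv ℝ f v z + r) • ν) ∈
          {ξ ∈ S | -Δ ≤ ⟪ξ - (x₀ + L v - f v • ν), u⟫} := by
  obtain ⟨ρ₁, hρ₁, hT⟩ := taylor_uniform hc.contDiffAt hη
  obtain ⟨s₁, hs₁, -, h2⟩ := hc.exists_depth hS hconv hint
  obtain ⟨ρ₂, hρ₂, h3⟩ := Metric.eventually_nhds_iff_ball.1 h2
  set ρ := min (min (ρ₁ / 2) (ρ₂ / 2)) (s₁ / 3) with hρ
  have hρ0 : 0 < ρ := by positivity
  refine ⟨min (s₁ / 3) (η * ρ ^ 2 / 2), by positivity, ?_⟩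
  have hf0 : Tendsto f (𝓝 0) (𝓝 0) := by
    simpa [ContinuousAt, hc.map_zero] using hc.contDiffAt.continuousAt
  have hfs : ∀ᶠ v in 𝓝 (0 : Euc m), f v < s₁ / 3 := hf0.eventually_lt_const (by positivity)
  have hfd : ∀ᶠ v in 𝓝 (0 : Euc m), ‖fderiv ℝ f v‖ < 1 :=
    hc.tendsto_fderiv.norm.eventually_lt_const (by simp)
  filter_upwards [ball_mem_nhds (0 : Euc m) hρ0, hfs, hfd, hc.eventually_normal hS hconv hint]
    with v hv hvs hvd hvn u hu Δ hΔ z r hr hrΔ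
  obtain ⟨hc0, hc1, -, hgrad⟩ := hvn u hu
  have hB := hc.hessian_nonneg hS z
  have hr0 : 0 ≤ r := le_trans (by positivity) hr
  have hΔ1 := hΔ.trans (min_le_left _ _)
  have hΔ2 := hΔ.trans (min_le_right _ _)
  have hz : ‖z‖ < ρ := by
    have h4 : η * ‖z‖ ^ 2 < η * ρ ^ 2 := by
      have : 0 < η * ρ ^ 2 := by positivity
      linarith
    exact lt_of_pow_lt_pow_left₀ 2 hρ0.le (lt_of_mul_lt_mul_left h4 hη.le)
  have hv' : ‖v‖ < ρ := by simpa using hv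
  have hvz : ‖v + z‖ < ρ + ρ := (norm_add_le _ _).trans_lt (by linarith)
  have e1 : ρ ≤ ρ₁ / 2 := (min_le_left _ _).trans (min_le_left _ _)
  have e2 : ρ ≤ ρ₂ / 2 := (min_le_left _ _).trans (min_le_right _ _)
  have e3 : ρ ≤ s₁ / 3 := min_le_right _ _
  have hTv := (hT v (by rw [mem_ball_zero_iff]; linarith) (v + z)
    (by rw [mem_ball_zero_iff]; linarith)).2
  rw [add_sub_cancel_left] at hTv
  have hTv' := (abs_le.1 hTv).2
  have hDz : fderiv ℝ f v z ≤ s₁ / 3 := by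
    calc _ ≤ ‖fderiv ℝ f v z‖ := Real.le_norm_self _
      _ ≤ ‖fderiv ℝ f v‖ * ‖z‖ := (fderiv ℝ f v).le_opNorm z
      _ ≤ 1 * ρ := by gcongr
      _ ≤ _ := by linarith
  constructor
  · have h5 := h3 (v + z) (by rw [mem_ball_zero_iff]; linarith) (f v + fderiv ℝ f v z + r)
      (by linarith) (by linarith)
    convert! h5 using 1
    rw [map_add]
    module
  · rw [add_sub_cancel_left, inner_sub_left, hgrad, inner_smul_left]
    simp only [conj_trivial]
    nlinarith

end IsGraphChart

/-- Injective endomorphisms are bounded below. -/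
lemma exists_norm_lower_bound {m : ℕ} {C : Euc m →ₗ[ℝ] Euc m} (hC : LinearMap.det C ≠ 0) :
    ∃ k > 0, ∀ z, k * ‖z‖ ^ 2 ≤ ‖C z‖ ^ 2 := by
  obtain ⟨K, hK, h⟩ := C.exists_antilipschitzWith
    (LinearMap.ker_eq_bot.2 (C.equivOfDetNeZero hC).injective)
  refine ⟨((K : ℝ) ^ 2)⁻¹, by positivity, fun z => ?_⟩
  have h1 := h.le_mul_dist z 0
  rw [map_zero, dist_zero_right, dist_zero_right] at h1
  rw [inv_mul_le_iff₀ (by positivity), ← mul_pow]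
  gcongr

namespace IsGraphChart

variable {m : ℕ} {S : Set (Euc (m + 1))} {x₀ ν : Euc (m + 1)}
  {L : Euc m →ₗᵢ[ℝ] Euc (m + 1)} {f : Euc m → ℝ}

lemma det_hessian_nonneg (hc : IsGraphChart S x₀ ν L f) (hS : IsClosed S) :
    0 ≤ (gramMatrix (fderiv ℝ (fderiv ℝ f) 0)).det := by
  obtain ⟨C, -, h⟩ := exists_factor _ hc.hessian_symm (hc.hessian_nonneg hS)
  rw [h]
  positivity

lemma norm_adjoint_frame_ge (hc : IsGraphChart S x₀ ν L f) {u : Euc (m + 1)} (hu : ‖u‖ = 1)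
    {L' : Euc m →ₗᵢ[ℝ] Euc (m + 1)} (hL' : ∀ v, ⟪L' v, u⟫ = 0) (z : Euc m) :
    ⟪ν, u⟫ ^ 2 * ‖z‖ ^ 2 ≤
      ‖ContinuousLinearMap.adjoint L.toContinuousLinearMap (L' z)‖ ^ 2 := by
  have h1 := norm_sq_eq_adjoint hc.norm_normal hc.orth (L' z)
  have h2 : ⟪L' z, ν⟫ = ⟪L' z, ν - ⟪ν, u⟫ • u⟫ := by
    rw [inner_sub_right, inner_smul_right, hL']
    simp
  have h3 : ‖ν - ⟪ν, u⟫ • u‖ ^ 2 = 1 - ⟪ν, u⟫ ^ 2 := by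
    rw [norm_sub_sq_real, inner_smul_right, norm_smul, hu, hc.norm_normal, Real.norm_eq_abs,
      mul_one, sq_abs]
    ring
  have h4 : ⟪L' z, ν⟫ ^ 2 ≤ ‖z‖ ^ 2 * (1 - ⟪ν, u⟫ ^ 2) := by
    rw [h2, ← h3, ← mul_pow, ← sq_abs]
    gcongr
    simpa using abs_real_inner_le_norm (L' z) (ν - ⟪ν, u⟫ • u)
  rw [L'.norm_map] at h1
  nlinarith

/-- Change of charts: the Hessian at a nearby boundary point dominates the pull-back of a
multiple of the Hessian at the base point. -/
lemma eventually_hessian_ge (hc : IsGraphChart S x₀ ν L f) (hS : IsClosed S) (hconv : Convex ℝ S)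
    (hint : (interior S).Nonempty) {C : Euc m →ₗ[ℝ] Euc m}
    (hC : ∀ z, fderiv ℝ (fderiv ℝ f) 0 z z = ‖C z‖ ^ 2) (hdet : LinearMap.det C ≠ 0)
    {θ : ℝ} (hθ1 : θ < 1) :
    ∀ᶠ x in 𝓝 x₀, ∀ u (L' : Euc m →ₗᵢ[ℝ] Euc (m + 1)) (f' : Euc m → ℝ),
      IsGraphChart S x u L' f' → θ ≤ ⟪ν, u⟫ ^ 2 ∧ 0 ≤ ⟪ν, u⟫ ∧ ⟪ν, u⟫ ≤ 1 ∧
        ∀ z, ⟪ν, u⟫ * θ *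
          ‖C (ContinuousLinearMap.adjoint L.toContinuousLinearMap (L' z))‖ ^ 2 ≤
            fderiv ℝ (fderiv ℝ f') 0 z z := by
  obtain ⟨k, hk, hCk⟩ := exists_norm_lower_bound hdet
  have hη : 0 < (1 - θ) * k / 2 := by
    have := sub_pos.2 hθ1
    positivity
  obtain ⟨ρ, hρ, hT⟩ := taylor_uniform hc.contDiffAt hη
  have hfd : ∀ᶠ v in 𝓝 (0 : Euc m), ‖fderiv ℝ f v‖ < 1 - θ :=
    hc.tendsto_fderiv.norm.eventually_lt_const (by simpa using hθ1)
  have hev := hc.eventually_eq _ (inter_mem (ball_mem_nhds (0 : Euc m) hρ)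
    (inter_mem hfd (hc.eventually_normal hS hconv hint)))
  filter_upwards [hev.eventually_nhds] with x hx u L' f' hc'
  obtain ⟨v, ⟨hvρ, hvd, hvn⟩, hxv⟩ := hx.self_of_nhds hc'.mem_frontier
  obtain ⟨hc0, hc1, hc2, hgrad⟩ := hvn u ⟨hc'.norm_normal, fun y hy => hxv ▸ hc'.inner_le y hy⟩
  have hvd' : ‖fderiv ℝ f v‖ < 1 - θ := hvd
  refine ⟨by linarith, hc0, hc1, fun z => ?_⟩
  set P := ContinuousLinearMap.adjoint L.toContinuousLinearMap with hP
  set c := ⟪ν, u⟫ with hcdef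
  have htz : Tendsto (fun t : ℝ => t • z) (𝓝[>] 0) (𝓝 0) := by
    have : ContinuousAt (fun t : ℝ => t • z) 0 := by fun_prop
    have h0 : Tendsto (fun t : ℝ => t • z) (𝓝 0) (𝓝 0) := by simpa [ContinuousAt] using this
    exact h0.mono_left nhdsWithin_le_nhds
  have hlim := hc'.tendsto_div_sq z
  have hmain : ∀ᶠ t : ℝ in 𝓝[>] 0,
      c * θ / 2 * ‖C (P (L' z) - (t * (f' (t • z) / t ^ 2)) • P u)‖ ^ 2 ≤
        f' (t • z) / t ^ 2 := by
    filter_upwards [htz.eventually hc'.eventually_mem,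
      htz.eventually (hc'.tendsto_graph.eventually hx), self_mem_nhdsWithin] with t ht1 ht2 ht
    have ht0 : (0 : ℝ) < t := ht
    obtain ⟨w, ⟨hwρ, -⟩, hw⟩ := ht2 ht1
    set a := f' (t • z) with ha
    have hdiff : L' (t • z) - a • u = L (w - v) - (f w - f v) • ν := by
      have e1 : x + L' (t • z) - a • u - x = L' (t • z) - a • u := by abel
      rw [← e1, hw]
      conv_lhs => rw [hxv]
      rw [map_sub]
      module
    have hd : w - v = t • P (L' z) - a • P u := by
      have e2 := adjoint_apply_frame hc.orth (w - v) (f w - f v)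
      rw [← hdiff, map_sub, map_smul, map_smul, map_smul] at e2
      exact e2.symm
    have hinner : a = c * (f w - f v - fderiv ℝ f v (w - v)) := by
      have e3 := congrArg (fun ξ => ⟪ξ, u⟫) hdiff
      simp only [inner_sub_left, hc'.orth, inner_smul_left, hgrad, real_inner_self_eq_norm_sq,
        hc'.norm_normal, conj_trivial] at e3
      linarith
    have hTw := (abs_le.1 (hT v hvρ w hwρ).2).1
    rw [hC] at hTw
    have hCw := hCk (w - v)
    have hge : c * θ / 2 * ‖C (w - v)‖ ^ 2 ≤ a := by
      rw [hinner]
      have h1θ := sub_pos.2 hθ1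
      have e4 : θ / 2 * ‖C (w - v)‖ ^ 2 ≤ f w - f v - fderiv ℝ f v (w - v) := by
        have := mul_le_mul_of_nonneg_left hCw h1θ.le
        linarith
      calc _ = c * (θ / 2 * ‖C (w - v)‖ ^ 2) := by ring
        _ ≤ _ := mul_le_mul_of_nonneg_left e4 hc0
    have e5 : w - v = t • (P (L' z) - (t * (a / t ^ 2)) • P u) := by
      rw [hd, smul_sub, smul_smul]
      congr 2
      field_simp
    rw [e5, map_smul, norm_smul, mul_pow, Real.norm_eq_abs, sq_abs] at hge
    rw [le_div_iff₀ (by positivity)]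
    linarith
  have hCc : Continuous C := C.continuous_of_finiteDimensional
  have hid : Tendsto (fun t : ℝ => t) (𝓝[>] 0) (𝓝 0) := tendsto_id.mono_left nhdsWithin_le_nhds
  have hz1 : Tendsto (fun t : ℝ => P (L' z) - (t * (f' (t • z) / t ^ 2)) • P u) (𝓝[>] 0)
      (𝓝 (P (L' z))) := by
    have := tendsto_const_nhds (x := P (L' z)) |>.sub ((hid.mul hlim).smul_const (P u))
    simpa using this
  have hlhs := ((((hCc.tendsto _).comp hz1).norm.pow 2).const_mul (c * θ / 2))
  have := le_of_tendsto_of_tendsto hlhs hlim hmain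
  linarith

/-- Lower semicontinuity of the Gauss curvature. -/
lemma eventually_det_hessian_ge (hc : IsGraphChart S x₀ ν L f) (hS : IsClosed S)
    (hconv : Convex ℝ S) (hint : (interior S).Nonempty) {ε : ℝ} (hε : 0 < ε) :
    ∀ᶠ x in 𝓝 x₀, ∀ u (L' : Euc m →ₗᵢ[ℝ] Euc (m + 1)) (f' : Euc m → ℝ),
      IsGraphChart S x u L' f' → (gramMatrix (fderiv ℝ (fderiv ℝ f) 0)).det - ε ≤
        (gramMatrix (fderiv ℝ (fderiv ℝ f') 0)).det := by
  obtain ⟨C, hC, hdetC⟩ := exists_factor _ hc.hessian_symm (hc.hessian_nonneg hS)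
  by_cases hdet : LinearMap.det C = 0
  · refine Eventually.of_forall fun x u L' f' hc' => ?_
    have := hc'.det_hessian_nonneg hS
    rw [hdetC, hdet]
    linarith
  obtain ⟨θ, hθ, hθ0, hθ1⟩ : ∃ θ : ℝ, LinearMap.det C ^ 2 - ε ≤ θ ^ (4 * m) * LinearMap.det C ^ 2
      ∧ 0 < θ ∧ θ < 1 := by
    have hcont : ContinuousAt (fun θ : ℝ => θ ^ (4 * m) * LinearMap.det C ^ 2) 1 := by fun_prop
    have h1 : ∀ᶠ θ in 𝓝 (1 : ℝ), LinearMap.det C ^ 2 - ε < θ ^ (4 * m) * LinearMap.det C ^ 2 :=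
      hcont.eventually_const_lt (by simpa using hε)
    have h2 : ∀ᶠ θ in 𝓝[<] (1 : ℝ), LinearMap.det C ^ 2 - ε < θ ^ (4 * m) * LinearMap.det C ^ 2 :=
      nhdsWithin_le_nhds h1
    have hpos : ∀ᶠ θ in 𝓝[<] (1 : ℝ), 0 < θ := nhdsWithin_le_nhds (lt_mem_nhds one_pos)
    have hlt : ∀ᶠ θ in 𝓝[<] (1 : ℝ), θ < 1 := self_mem_nhdsWithin
    obtain ⟨θ, h3, h4, h5⟩ := (h2.and (hpos.and hlt)).exists
    exact ⟨θ, h3.le, h4, h5⟩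
  filter_upwards [hc.eventually_hessian_ge hS hconv hint hC hdet hθ1] with x hx u L' f' hc'
  obtain ⟨hcθ, hc0, hc1, hle⟩ := hx u L' f' hc'
  obtain ⟨C', hC', hdetC'⟩ := exists_factor _ hc'.hessian_symm (hc'.hessian_nonneg hS)
  rw [hdetC, hdetC']
  refine hθ.trans ?_
  set c := ⟪ν, u⟫ with hcdef
  have hθc : θ ≤ c := by nlinarith
  set M : Euc m →ₗ[ℝ] Euc m :=
    (ContinuousLinearMap.adjoint L.toContinuousLinearMap).toLinearMap ∘ₗ L'.toLinearMap with hM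
  have hMdet : c ^ m ≤ |LinearMap.det M| := by
    have h1 : ∀ z, ‖(c • LinearMap.id : Euc m →ₗ[ℝ] Euc m) z‖ ≤ ‖M z‖ := by
      intro z
      have h2 := hc.norm_adjoint_frame_ge hc'.norm_normal hc'.orth z
      rw [← mul_pow] at h2
      have h3 := (pow_le_pow_iff_left₀ (by positivity) (norm_nonneg _) two_ne_zero).1 h2
      rw [LinearMap.smul_apply, norm_smul, Real.norm_eq_abs, abs_of_nonneg hc0]
      exact h3
    have h4 := abs_det_le_abs_det h1
    rw [LinearMap.det_smul] at h4
    simpa [abs_of_nonneg hc0] using h4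
  have hdet_le : (√(c * θ)) ^ m * (|LinearMap.det C| * |LinearMap.det M|) ≤
      |LinearMap.det C'| := by
    have h1 : ∀ z, ‖(√(c * θ) • (C ∘ₗ M)) z‖ ≤ ‖C' z‖ := by
      intro z
      have h2 := hle z
      rw [hC', ← Real.sq_sqrt (mul_nonneg hc0 hθ0.le), ← mul_pow] at h2
      have h3 := (pow_le_pow_iff_left₀ (by positivity) (norm_nonneg _) two_ne_zero).1 h2
      rw [LinearMap.smul_apply, norm_smul, Real.norm_eq_abs, abs_of_nonneg (Real.sqrt_nonneg _)]
      exact h3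
    have h4 := abs_det_le_abs_det h1
    rw [LinearMap.det_smul, LinearMap.det_comp, abs_mul, abs_mul] at h4
    simpa [abs_of_nonneg (Real.sqrt_nonneg _)] using h4
  have hsqrt : θ ≤ √(c * θ) := Real.le_sqrt_of_sq_le (by nlinarith)
  have hfin : θ ^ m * (|LinearMap.det C| * θ ^ m) ≤ |LinearMap.det C'| := by
    refine le_trans ?_ hdet_le
    gcongr
    exact le_trans (by gcongr) hMdet
  calc θ ^ (4 * m) * LinearMap.det C ^ 2 = (θ ^ m * (|LinearMap.det C| * θ ^ m)) ^ 2 := by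
        rw [← sq_abs (LinearMap.det C)]; ring
    _ ≤ |LinearMap.det C'| ^ 2 := by gcongr
    _ = _ := sq_abs _

/-- Uniform lower bound for the volume of caps near the base point. -/
lemma eventually_volume_cap_ge (hc : IsGraphChart S x₀ ν L f) (hS : IsCompact S)
    (hconv : Convex ℝ S) (hint : (interior S).Nonempty) {ε : ℝ} (hε : 0 < ε) :
    ∃ δ > 0, ∀ᶠ x in 𝓝 x₀, x ∈ frontier S → ∀ u, IsOuterNormalAt S x u → ∀ Δ, 0 < Δ → Δ ≤ δ →
      (2 * Δ) ^ ((m : ℝ) / 2 + 1) / (m + 2) *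
        ((volume (ball (0 : Euc m) 1)).toReal /
          √((gramMatrix (fderiv ℝ (fderiv ℝ f) 0)).det + ε)) ≤
        (volume {ξ ∈ S | -Δ ≤ ⟪ξ - x, u⟫}).toReal := by
  set B := fderiv ℝ (fderiv ℝ f) 0 with hB
  obtain ⟨I, hI⟩ : ∃ I : Euc m →L[ℝ] Euc m →L[ℝ] ℝ, ∀ z w, I z w = ⟪z, w⟫ :=
    ⟨innerSL ℝ, fun _ _ => rfl⟩
  have hgram : ∀ η : ℝ, gramMatrix (B + (2 * η) • I) =
      gramMatrix B + (2 * η) • gramMatrix I := by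
    intro η
    ext i j
    simp [gramMatrix]
  obtain ⟨η, hη, hdetlt⟩ : ∃ η > (0 : ℝ), (gramMatrix (B + (2 * η) • I)).det <
      (gramMatrix B).det + ε := by
    have hcont : Continuous fun η : ℝ =>
        (gramMatrix B + (2 * η) • gramMatrix I).det := by
      apply Continuous.matrix_det
      fun_prop
    have h1 : ∀ᶠ η in 𝓝 (0 : ℝ),
        (gramMatrix B + (2 * η) • gramMatrix I).det < (gramMatrix B).det + ε :=
      (hcont.tendsto 0).eventually_lt_const (by simpa using hε)
    have h1' : ∀ᶠ η in 𝓝[>] (0 : ℝ),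
        (gramMatrix B + (2 * η) • gramMatrix I).det < (gramMatrix B).det + ε :=
      nhdsWithin_le_nhds h1
    have hpos : ∀ᶠ η in 𝓝[>] (0 : ℝ), 0 < η := self_mem_nhdsWithin
    obtain ⟨η, h2, h3⟩ := (h1'.and hpos).exists
    exact ⟨η, h3, by rwa [hgram]⟩
  have hquad : ∀ z, (B + (2 * η) • I) z z = B z z + 2 * η * ‖z‖ ^ 2 := by
    intro z
    change B z z + (2 * η) * I z z = _
    rw [hI, real_inner_self_eq_norm_sq]
  have hBpos := hc.hessian_nonneg hS.isClosed
  obtain ⟨T, hT, hTdet⟩ := exists_factor (B + (2 * η) • I)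
    (fun z w => by
      change B z w + (2 * η) * I z w = B w z + (2 * η) * I w z
      rw [hI, hI, real_inner_comm, hc.hessian_symm])
    (fun z => by
      rw [hquad]
      have := hBpos z
      positivity)
  have hT0 : LinearMap.det T ≠ 0 := by
    have hinj : Function.Injective T := by
      rw [injective_iff_map_eq_zero]
      intro z hz
      have h1 := hT z
      rw [hquad, hz, norm_zero] at h1
      have h2 := hBpos z
      have h3 : ‖z‖ ^ 2 = 0 := by
        have : 0 ≤ η * ‖z‖ ^ 2 := by positivity
        have : η * ‖z‖ ^ 2 = 0 := by nlinarith
        exact (mul_eq_zero.1 this).resolve_left hη.ne'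
      simpa using h3
    have := (LinearMap.isUnit_iff_ker_eq_bot T).2 (LinearMap.ker_eq_bot.2 hinj)
    exact (this.map LinearMap.det).ne_zero
  obtain ⟨δ, hδ, hcap⟩ := hc.paraboloid_subset_cap hS.isClosed hconv hint hη
  refine ⟨δ, hδ, ?_⟩
  filter_upwards [hc.eventually_eq _ hcap] with x hx hxS u hu Δ hΔ hΔδ
  obtain ⟨v, hv, rfl⟩ := hx hxS
  have hsub := hv u hu Δ hΔδ
  set x := x₀ + L v - f v • ν with hxdef
  have hcapm : MeasurableSet {ξ ∈ S | -Δ ≤ ⟪ξ - x, u⟫} :=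
    hS.isClosed.measurableSet.inter
      (measurableSet_le (f := fun _ => -Δ) (g := fun ξ => ⟪ξ - x, u⟫) (by fun_prop) (by fun_prop))
  have hmp := measurePreserving_graph hc.norm_normal hc.orth x (fderiv ℝ f v)
  have hle : volume {p : Euc m × ℝ | ‖T p.1‖ ^ 2 / 2 ≤ p.2 ∧ p.2 ≤ Δ} ≤
      volume {ξ ∈ S | -Δ ≤ ⟪ξ - x, u⟫} := by
    rw [← hmp.measure_preimage hcapm.nullMeasurableSet]
    refine measure_mono fun p hp => hsub p.1 p.2 ?_ hp.2
    refine le_trans (le_of_eq ?_) hp.1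
    rw [← hT, hquad]
    ring
  have hfin : volume {ξ ∈ S | -Δ ≤ ⟪ξ - x, u⟫} ≠ ⊤ :=
    measure_ne_top_of_subset (fun ξ hξ => hξ.1) hS.measure_lt_top.ne
  have hle' := ENNReal.toReal_mono hfin hle
  rw [volume_paraboloid hT0 hΔ.le, ENNReal.toReal_mul, ENNReal.toReal_ofReal (by positivity)]
    at hle'
  refine le_trans ?_ hle'
  have hsq : |LinearMap.det T| ≤ √((gramMatrix B).det + ε) := by
    refine Real.le_sqrt_of_sq_le ?_
    rw [sq_abs, ← hTdet]
    exact hdetlt.le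
  calc _ ≤ (2 * Δ) ^ ((m : ℝ) / 2 + 1) / (m + 2) *
        ((volume (ball (0 : Euc m) 1)).toReal / |LinearMap.det T|) := by
        gcongr
    _ = _ := by ring

end IsGraphChart

/-- A property that holds for each fixed tolerance once `Δ` is small holds with a tolerance
tending to zero. -/
lemma exists_tendsto_zero_of_forall_pos {P : ℝ → ℝ → Prop}
    (hmono : ∀ Δ η η', 0 < η → η ≤ η' → P η Δ → P η' Δ)
    (h : ∀ η > 0, ∃ δ > 0, ∀ Δ, 0 < Δ → Δ ≤ δ → P η Δ) :
    ∃ φ : ℝ → ℝ, (∀ Δ, 0 ≤ φ Δ) ∧ Tendsto φ (𝓝[>] 0) (𝓝 0) ∧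
      ∃ Δ₀ > 0, ∀ Δ, 0 < Δ → Δ ≤ Δ₀ → P (φ Δ) Δ := by
  have hbdd : ∀ Δ, BddBelow {η | 0 < η ∧ P η Δ} := fun Δ => ⟨0, fun η hη => hη.1.le⟩
  have hnonneg : ∀ Δ, 0 ≤ sInf {η | 0 < η ∧ P η Δ} := fun Δ =>
    Real.sInf_nonneg fun η hη => hη.1.le
  refine ⟨fun Δ => sInf {η | 0 < η ∧ P η Δ} + |Δ|, fun Δ => add_nonneg (hnonneg Δ) (abs_nonneg Δ),
    ?_, ?_⟩
  · have habs : Tendsto (fun Δ : ℝ => |Δ|) (𝓝[>] 0) (𝓝 0) := by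
      have : Tendsto (fun Δ : ℝ => |Δ|) (𝓝 0) (𝓝 |0|) := continuous_abs.tendsto 0
      rw [abs_zero] at this
      exact this.mono_left nhdsWithin_le_nhds
    have hinf : Tendsto (fun Δ => sInf {η | 0 < η ∧ P η Δ}) (𝓝[>] 0) (𝓝 0) := by
      refine tendsto_order.2 ⟨fun a ha => Eventually.of_forall fun Δ => ha.trans_le (hnonneg Δ),
        fun a ha => ?_⟩
      obtain ⟨δ, hδ, hP⟩ := h (a / 2) (half_pos ha)
      filter_upwards [Ioc_mem_nhdsGT hδ] with Δ hΔ
      exact (csInf_le (hbdd Δ) ⟨half_pos ha, hP Δ hΔ.1 hΔ.2⟩).trans_lt (half_lt_self ha)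
    simpa using hinf.add habs
  · obtain ⟨δ, hδ, hP⟩ := h 1 one_pos
    refine ⟨δ, hδ, fun Δ hΔ hΔδ => ?_⟩
    obtain ⟨η, ⟨hη, hPη⟩, hlt⟩ := exists_lt_of_csInf_lt
      (s := {η | 0 < η ∧ P η Δ}) (b := sInf {η | 0 < η ∧ P η Δ} + |Δ|)
      ⟨1, one_pos, hP Δ hΔ hΔδ⟩ (lt_add_of_pos_right _ (abs_pos.2 hΔ.ne'))
    exact hmono Δ η _ hη hlt.le hPη

lemma gaussCurvature_nonneg {m : ℕ} {S : Set (Euc (m + 1))} {x ν : Euc (m + 1)} {k : ℝ}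
    (hS : IsClosed S) (hν : IsOuterNormalAt S x ν) (hk : IsGaussCurvatureAt S x ν k) : 0 ≤ k := by
  obtain ⟨L, f, hc, rfl⟩ := exists_graphChart hν hk
  exact hc.det_hessian_nonneg hS

lemma exists_forall_volume_cap_ge {m : ℕ} {S : Set (Euc (m + 1))}
    {u : Euc (m + 1) → Euc (m + 1)} {κ : Euc (m + 1) → ℝ} (hS : IsCompact S)
    (hconv : Convex ℝ S) (hint : (interior S).Nonempty) (hC2 : IsC2Body S u κ) {η : ℝ}
    (hη : 0 < η) :
    ∃ δ > 0, ∀ x ∈ frontier S, ∀ Δ, 0 < Δ → Δ ≤ δ →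
      (2 * Δ) ^ ((m : ℝ) / 2 + 1) / (m + 2) *
        ((volume (ball (0 : Euc m) 1)).toReal / √(κ x + η)) ≤
        (volume {ξ ∈ S | -Δ ≤ ⟪ξ - x, u x⟫}).toReal := by
  have hfr : IsCompact (frontier S) :=
    hS.of_isClosed_subset isClosed_frontier hS.isClosed.frontier_subset
  have hloc : ∀ x₀ ∈ frontier S, ∃ δ > 0, ∀ᶠ x in 𝓝 x₀, x ∈ frontier S → ∀ Δ, 0 < Δ → Δ ≤ δ →
      (2 * Δ) ^ ((m : ℝ) / 2 + 1) / (m + 2) *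
        ((volume (ball (0 : Euc m) 1)).toReal / √(κ x + η)) ≤
        (volume {ξ ∈ S | -Δ ≤ ⟪ξ - x, u x⟫}).toReal := by
    intro x₀ hx₀
    obtain ⟨L, f, hc, hk⟩ := exists_graphChart (hC2 x₀ hx₀).1 (hC2 x₀ hx₀).2
    obtain ⟨δ, hδ, hvol⟩ := hc.eventually_volume_cap_ge hS hconv hint (half_pos hη)
    refine ⟨δ, hδ, ?_⟩
    filter_upwards [hvol, hc.eventually_det_hessian_ge hS.isClosed hconv hint (half_pos hη)]
      with x hx hdet hxS Δ hΔ hΔδ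
    refine le_trans ?_ (hx hxS (u x) (hC2 x hxS).1 Δ hΔ hΔδ)
    obtain ⟨L', f', hc', hk'⟩ := exists_graphChart (hC2 x hxS).1 (hC2 x hxS).2
    have h1 := hdet (u x) L' f' hc'
    have h2 := hc.det_hessian_nonneg hS.isClosed
    have h3 : (gramMatrix (fderiv ℝ (fderiv ℝ f) 0)).det + η / 2 ≤ κ x + η := by
      rw [hk']
      linarith
    gcongr
  choose! δ hδ hev using hloc
  obtain ⟨t, ht, hcover⟩ := hfr.elim_nhds_subcover _ hev
  have hsmall : ∀ᶠ Δ in 𝓝[>] (0 : ℝ), ∀ x₀ ∈ t, Δ ≤ δ x₀ :=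
    nhdsWithin_le_nhds ((t.eventually_all).2 fun x₀ hx₀ => ge_mem_nhds (hδ x₀ (ht x₀ hx₀)))
  have hpos : ∀ᶠ Δ in 𝓝[>] (0 : ℝ), 0 < Δ := self_mem_nhdsWithin
  obtain ⟨d, hd, hd0⟩ := (hsmall.and hpos).exists
  refine ⟨d, hd0, fun x hx Δ hΔ hΔd => ?_⟩
  obtain ⟨x₀, hx₀, hxx₀⟩ := mem_iUnion₂.1 (hcover hx)
  exact hxx₀ hx Δ hΔ (hΔd.trans (hd x₀ hx₀))

/-- Lemma 2.9: for `S` centrally symmetric with `C²` boundary there is a nonnegative function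
`φ` with `φ(Δ) → 0` such that for every `x ∈ ∂S` and all small `Δ > 0`,
`((2Δ)^{(n+1)/2}/(n+1))·|B₂^{n−1}|/(κ(x)+φ(Δ))^{1/2} ≤ |{ξ ∈ S : ⟨ξ−x,u(x)⟩ ≥ −Δ}|ₙ`. -/
theorem statement13 {n : ℕ} (hn : 2 ≤ n) (S : Set (Euc n))
    (u : Euc n → Euc n) (κ : Euc n → ℝ)
    (hS : IsSymConvexBody S) (hC2 : IsC2Body S u κ) :
    ∃ φ : ℝ → ℝ, (∀ Δ, 0 ≤ φ Δ) ∧ Tendsto φ (𝓝[>] 0) (𝓝 0) ∧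
      ∃ Δ₀ > (0:ℝ), ∀ x ∈ frontier S, ∀ Δ : ℝ, 0 < Δ → Δ ≤ Δ₀ →
        (2*Δ) ^ (((n:ℝ)+1)/2) / ((n:ℝ)+1) *
            ((volume (ball (0 : Euc (n-1)) 1)).toReal / (κ x + φ Δ) ^ ((1:ℝ)/2))
          ≤ (volume {ξ ∈ S | -Δ ≤ ⟪ξ - x, u x⟫}).toReal := by
  obtain ⟨m, rfl⟩ : ∃ m, n = m + 1 := ⟨n - 1, by omega⟩
  obtain ⟨hcomp, hconv, hint, -⟩ := hS
  obtain ⟨φ, hφ, hlim, Δ₀, hΔ₀, hP⟩ := exists_tendsto_zero_of_forall_pos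
    (P := fun η Δ => ∀ x ∈ frontier S, 0 < Δ → (2 * Δ) ^ ((m : ℝ) / 2 + 1) / (m + 2) *
        ((volume (ball (0 : Euc m) 1)).toReal / √(κ x + η)) ≤
        (volume {ξ ∈ S | -Δ ≤ ⟪ξ - x, u x⟫}).toReal)
    (fun Δ η η' hη hle h x hx hΔ => by
      refine le_trans ?_ (h x hx hΔ)
      have := gaussCurvature_nonneg hcomp.isClosed (hC2 x hx).1 (hC2 x hx).2
      gcongr)
    (fun η hη => by
      obtain ⟨δ, hδ, h⟩ := exists_forall_volume_cap_ge hcomp hconv hint hC2 hη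
      exact ⟨δ, hδ, fun Δ hΔ hΔδ x hx _ => h x hx Δ hΔ hΔδ⟩)
  refine ⟨φ, hφ, hlim, Δ₀, hΔ₀, fun x hx Δ hΔ hΔΔ₀ => ?_⟩
  have h1 : (((m + 1 : ℕ) : ℝ) + 1) / 2 = (m : ℝ) / 2 + 1 := by push_cast; ring
  have h2 : ((m + 1 : ℕ) : ℝ) + 1 = m + 2 := by push_cast; ring
  rw [h1, h2, ← Real.sqrt_eq_rpow]
  exact hP Δ hΔ hΔΔ₀ x hx hΔ
end
end
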